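/- If φ is an index-strict primed compatible sequence, then P_HMᴼ(φ) = Q_SWᴼ(φ^⊤) and Q_HMᴼ(φ) = P_SWᴼ(φ^⊤); moreover P_HM^Sp(φ) = Q_SW^Sp(φ^⊤) and Q_HM^Sp(φ) = P_SW^Sp(φ^⊤). -/

import Mathlib

/-! ## Primed letters: the alphabet `ℤ ⊔ ℤ'`, with `i' = i - 1/2`.
A letter is encoded by its "ceiling" together with a flag recording whether it is primed. -/

structure Letter where
  ceil : ℤ
  primed : Bool
deriving DecidableEq, Repr

instance : Inhabited Letter := ⟨⟨0, false⟩⟩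

/-- The order `⋯ < 1' < 1 < 2' < 2 < ⋯`. -/
instance : LinearOrder Letter :=
  LinearOrder.lift' (fun x : Letter => toLex (x.ceil, !x.primed))
    (fun a b h => by
      have h' : (a.ceil, !a.primed) = (b.ceil, !b.primed) := toLex.injective h
      obtain ⟨ac, ap⟩ := a
      obtain ⟨bc, bp⟩ := b
      simp only [Prod.mk.injEq] at h'
      obtain ⟨h1, h2⟩ := h'
      cases ap <;> cases bp <;> simp_all)

/-- A primed word. -/
abbrev PWord := List Letter

def Letter.unprime (x : Letter) : Letter := ⟨x.ceil, false⟩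

def Letter.succL (x : Letter) : Letter := ⟨x.ceil + 1, x.primed⟩

/-- `unprime` of a primed word: replace each letter `x` by `⌈x⌉`. -/
def unprimeWord (a : PWord) : List ℤ := a.map Letter.ceil

/-- `unprime` of a primed word, as a primed word with no primes. -/
def unprimeP (a : PWord) : PWord := a.map Letter.unprime

/-! ## Involution words -/

/-- The simple transposition `s_i = (i, i+1)` of `ℤ`. -/
def sPerm (i : ℤ) : Equiv.Perm ℤ := Equiv.swap i (i + 1)

/-- The Demazure product `s_{w_1} ∘ s_{w_2} ∘ ⋯ ∘ s_{w_k}` of a word, computed by the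
defining recursion `σ ∘ s_i = σ·s_i` if `σ(i) < σ(i+1)` and `σ ∘ s_i = σ` otherwise. -/
def heckeProd (w : List ℤ) : Equiv.Perm ℤ :=
  w.foldl (fun σ i => if σ i < σ (i + 1) then σ * sPerm i else σ) 1

/-- `s_{a_n} ∘ ⋯ ∘ s_{a_2} ∘ s_{a_1} ∘ s_{a_2} ∘ ⋯ ∘ s_{a_n}` for `a = a_1 a_2 ⋯ a_n`. -/
def invHecke (a : List ℤ) : Equiv.Perm ℤ := heckeProd (a.reverse ++ a.tail)

/-- Membership in `I_ℤ`: a finitely supported involution of `ℤ`. -/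
def IZ (z : Equiv.Perm ℤ) : Prop := {x : ℤ | z x ≠ x}.Finite ∧ z * z = 1

/-- The set of involution words of `z`. -/
def Rinv (z : Equiv.Perm ℤ) : Set (List ℤ) :=
  {a | invHecke a = z ∧ ∀ b : List ℤ, invHecke b = z → a.length ≤ b.length}

/-- 0-based index `k` is a commutation in the word `a` (this corresponds to the 1-based
index `k+1`): `a_{k+1}` and `a_{k+1} + 1` are both fixed points of
`s_{a_k} ∘ ⋯ ∘ s_{a_1} ∘ ⋯ ∘ s_{a_k}`. -/
def IsCommutation (a : List ℤ) (k : ℕ) : Prop :=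
  ∃ x, a[k]? = some x ∧ invHecke (a.take k) x = x ∧ invHecke (a.take k) (x + 1) = x + 1

/-- The set of primed involution words of `z`. -/
def RinvPlus (z : Equiv.Perm ℤ) : Set PWord :=
  {a | unprimeWord a ∈ Rinv z ∧
     ∀ (k : ℕ) (x : Letter), a[k]? = some x → x.primed = true →
       IsCommutation (unprimeWord a) k}

/-! ## Shifted tableaux.
A shifted tableau is recorded as its list of rows, from the first (bottom) row upward;
the entry at 0-based index `k` of 0-based row `r` occupies the box in row `r+1` and
column `r+1+k` of the shifted diagram. -/

abbrev STab := List (List Letter)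

/-- A strict partition, recorded as its (strictly decreasing) list of positive parts. -/
def IsStrictPartition (sh : List ℕ) : Prop :=
  List.Chain' (fun a b => b < a) sh ∧ ∀ m ∈ sh, 0 < m

def shapeOf {α : Type*} (T : List (List α)) : List ℕ := T.map List.length

/-- The rows form the shifted diagram of a strict partition. -/
def IsShifted {α : Type*} (T : List (List α)) : Prop := IsStrictPartition (shapeOf T)

/-- The entry of `T` in (0-based) row `r` and column `c` of the shifted diagram. -/
def entryG? {α : Type*} (T : List (List α)) (r c : ℕ) : Option α :=
  if r ≤ c then (T[r]?).bind (fun row => row[c - r]?) else none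

def entry? (T : STab) (r c : ℕ) : Option Letter := entryG? T r c

def setRowG {α : Type*} (T : List (List α)) (r : ℕ) (row : List α) : List (List α) :=
  if r < T.length then T.set r row else T ++ [row]

def setEntryG {α : Type*} (T : List (List α)) (r c : ℕ) (x : α) : List (List α) :=
  T.set r ((T.getD r []).set (c - r) x)

def numCols {α : Type*} (T : List (List α)) : ℕ := (T.getD 0 []).length

/-- Row reading word: rows left to right, starting with the last (top) row. -/
def rowWord (T : STab) : PWord := T.reverse.flatten

/-- Column reading word: columns top to bottom, starting with the first column. -/
def colWord (T : STab) : PWord :=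
  (List.range (numCols T)).flatMap (fun c =>
    ((List.range (c + 1)).reverse).filterMap (fun r => entry? T r c))

def unprimeT (T : STab) : STab := T.map (List.map Letter.unprime)

/-- Remove the primes from all main-diagonal entries. -/
def unprimeDiagT (T : STab) : STab :=
  T.map (fun row =>
    match row with
    | [] => []
    | x :: rest => Letter.unprime x :: rest)

/-- Rows and columns are strictly increasing. -/
def IsIncreasing (T : STab) : Prop :=
  (∀ r c x y, entry? T r c = some x → entry? T r (c + 1) = some y → x < y) ∧
  (∀ r c x y, entry? T r c = some x → entry? T (r + 1) c = some y → x < y)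

/-- No primed entries on the main diagonal. -/
def NoDiagPrimes (T : STab) : Prop :=
  ∀ r x, entry? T r r = some x → x.primed = false

/-- Entries positive, rows and columns weakly increasing, no primed entry repeated
in a row and no unprimed entry repeated in a column. -/
def IsSemistandard (T : STab) : Prop :=
  (∀ x ∈ T.flatten, 0 < x.ceil) ∧
  (∀ r c x y, entry? T r c = some x → entry? T r (c + 1) = some y → x ≤ y) ∧
  (∀ r c x y, entry? T r c = some x → entry? T (r + 1) c = some y → x ≤ y) ∧
  (∀ r c c' x, c < c' → entry? T r c = some x → entry? T r c' = some x →
    x.primed = false) ∧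
  (∀ r r' c x, r < r' → entry? T r c = some x → entry? T r' c = some x →
    x.primed = true)

/-- Increasing, with exactly one of `i` or `i'` as an entry for each `i = 1, …, n`,
where `n` is the number of boxes. -/
def IsStandard (T : STab) : Prop :=
  IsIncreasing T ∧
  ∀ i : ℤ, 1 ≤ i → i ≤ (T.flatten.length : ℤ) →
    T.flatten.countP (fun x => decide (x.ceil = i)) = 1
/-! ## Orthogonal Edelman–Greene insertion -/

/-- "Switching the primes" of a pair: reverse the primes on both letters if exactly one
of them is unprimed, and leave them unchanged otherwise. -/
def switchPrimes (x y : Letter) : Letter × Letter :=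
  if x.primed = y.primed then (x, y)
  else (⟨x.ceil, !x.primed⟩, ⟨y.ceil, !y.primed⟩)

/-- Column-insertion stage of orthogonal Edelman–Greene insertion:
insert letter `w` into column `c` of `T` (then continue into later columns). -/
def egCol : ℕ → STab → ℕ → Letter → STab × Bool
  | 0, T, _, _ => (T, true)
  | fuel + 1, T, c, w =>
    let occ := (List.range (c + 1)).filterMap (fun r => (entry? T r c).map (fun x => (r, x)))
    match occ.findIdx? (fun p => decide (w.ceil < p.2.ceil)) with
    | none =>
        -- place `w` in the first empty box of the column
        let r := occ.length
        let w' := if r = c ∧ w.primed then Letter.unprime w else w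
        (setRowG T r ((T.getD r []) ++ [w']), if r = c then w.primed else true)
    | some kM =>
        let km := (occ.findIdx? (fun p => decide (w.ceil ≤ p.2.ceil))).getD kM
        let im := (occ.getD km (0, default)).1
        let m := (occ.getD km (0, default)).2
        if km = kM then
          if im = c then
            -- m = M on the main diagonal
            egCol fuel (setEntryG T im c (Letter.unprime w)) (c + 1) ⟨m.ceil, w.primed⟩
          else
            -- m = M off the main diagonal
            egCol fuel (setEntryG T im c w) (c + 1) m
        else
          -- m < M : switch the primes on m and M, insert w+1 into the next column
          let iM := (occ.getD kM (0, default)).1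
          let M := (occ.getD kM (0, default)).2
          let p := switchPrimes m M
          egCol fuel (setEntryG (setEntryG T im c p.1) iM c p.2) (c + 1) (Letter.succL w)

/-- Row-insertion stage of orthogonal Edelman–Greene insertion:
insert letter `w` into row `r` of `T`. -/
def egRow : ℕ → STab → ℕ → Letter → STab × Bool
  | 0, T, _, _ => (T, true)
  | fuel + 1, T, r, w =>
    let row := T.getD r []
    match row.findIdx? (fun x => decide (w.ceil < x.ceil)) with
    | none =>
        if row.isEmpty ∧ w.primed then (setRowG T r [Letter.unprime w], true)
        else (setRowG T r (row ++ [w]), false)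
    | some kM =>
        let km := (row.findIdx? (fun x => decide (w.ceil ≤ x.ceil))).getD kM
        let m := row.getD km default
        if km = kM then
          if km = 0 then
            -- m = M on the main diagonal
            egCol fuel (setRowG T r (row.set 0 (Letter.unprime w))) (r + 1)
              ⟨m.ceil, w.primed⟩
          else
            -- m = M off the main diagonal
            egRow fuel (setRowG T r (row.set km w)) (r + 1) m
        else
          -- m < M : switch primes; insert w+1 into the next column (if m is on the
          -- main diagonal) or the next row (otherwise)
          let M := row.getD kM default
          let p := switchPrimes m M
          let row' := (row.set km p.1).set kM p.2
          if km = 0 then egCol fuel (setRowG T r row') (r + 1) (Letter.succL w)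
          else egRow fuel (setRowG T r row') (r + 1) (Letter.succL w)

/-- `T ←ᴼ u` together with the flag recording whether the insertion ended in
column insertion. -/
def egInsert (T : STab) (u : Letter) : STab × Bool :=
  egRow (T.flatten.length + T.length + 2) T 0 u

/-- The orthogonal Edelman–Greene insertion tableau `P_EGᴼ(a)`. -/
def PEG (a : PWord) : STab := a.foldl (fun T u => (egInsert T u).1) []

/-- Add the recording letter `x` to `Q` in the unique box of `Pnew` not in `Pold`. -/
def addBox (Q Pold Pnew : STab) (x : Letter) : STab :=
  match (List.range Pnew.length).find?
      (fun r => decide ((Pold.getD r []).length ≠ (Pnew.getD r []).length)) with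
  | some r => setRowG Q r ((Q.getD r []) ++ [x])
  | none => Q

def QEGaux : STab → STab → ℕ → PWord → STab
  | _, Q, _, [] => Q
  | P, Q, n, u :: rest =>
      let res := egInsert P u
      QEGaux res.1 (addBox Q P res.1 ⟨(n : ℤ), res.2⟩) (n + 1) rest

/-- The orthogonal Edelman–Greene recording tableau `Q_EGᴼ(a)`. -/
def QEG (a : PWord) : STab := QEGaux [] [] 1 a

/-! ## Orthogonal Coxeter–Knuth operators -/

def ock1 (x : Letter) : Letter := ⟨x.ceil, !x.primed⟩

def ock2 (x y : Letter) : Letter × Letter := (⟨y.ceil, x.primed⟩, ⟨x.ceil, y.primed⟩)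

def ock3 (x y z : Letter) : Letter × Letter × Letter :=
  if x.ceil = z.ceil ∧ (x.ceil - y.ceil = 1 ∨ y.ceil - x.ceil = 1) then
    if x.primed = false ∧ y.primed = false ∧ z.primed = false then
      -- XYX ↔ YXY
      (⟨y.ceil, false⟩, ⟨x.ceil, false⟩, ⟨y.ceil, false⟩)
    else if x.primed = true ∧ y.primed = false ∧ z.primed = false then
      -- X'YX ↦ YXY'
      (⟨y.ceil, false⟩, ⟨x.ceil, false⟩, ⟨y.ceil, true⟩)
    else if x.primed = false ∧ y.primed = false ∧ z.primed = true then
      -- YXY' ↦ X'YX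
      (⟨y.ceil, true⟩, ⟨x.ceil, false⟩, ⟨y.ceil, false⟩)
    else (x, y, z)
  else if (x.ceil < z.ceil ∧ z.ceil < y.ceil) ∨ (y.ceil < z.ceil ∧ z.ceil < x.ceil) then
    -- ACB ↔ CAB
    (y, x, z)
  else if (y.ceil < x.ceil ∧ x.ceil < z.ceil) ∨ (z.ceil < x.ceil ∧ x.ceil < y.ceil) then
    -- BCA ↔ BAC
    (x, z, y)
  else (x, y, z)

/-- The operator `ock_i` for `i ∈ ℤ`. -/
def ockW (i : ℤ) (a : PWord) : PWord :=
  if i = -1 then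
    match a with
    | [] => []
    | x :: rest => ock1 x :: rest
  else if i = 0 then
    match a with
    | x :: y :: rest => (ock2 x y).1 :: (ock2 x y).2 :: rest
    | _ => a
  else if 1 ≤ i ∧ i + 2 ≤ (a.length : ℤ) then
    let k := (i - 1).toNat
    match a[k]?, a[k + 1]?, a[k + 2]? with
    | some x, some y, some z =>
        a.take k ++ [(ock3 x y z).1, (ock3 x y z).2.1, (ock3 x y z).2.2] ++ a.drop (k + 3)
    | _, _, _ => a
  else a

/-- Orthogonal Coxeter–Knuth equivalence: generated by `a ∼ ock_i(a)` for all `i ∈ ℤ`. -/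
def OckEquiv : PWord → PWord → Prop :=
  Relation.EqvGen (fun a b => ∃ i : ℤ, b = ockW i a)
/-! ## Descents -/

/-- Descent set of a primed word (as a set of 1-based positions). -/
def DesWord (a : PWord) : Set ℤ :=
  {i | ∃ k : ℕ, i = (k : ℤ) + 1 ∧ ∃ x y, a[k]? = some x ∧ a[k + 1]? = some y ∧ y < x}

/-- Descent set of a standard shifted tableau. -/
def DesT (T : STab) : Set ℤ :=
  {i | 0 < i ∧ (
    (∃ r c r' c', entry? T r c = some ⟨i, false⟩ ∧
        entry? T r' c' = some ⟨i + 1, false⟩ ∧ r < r') ∨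
    (∃ r c r' c', entry? T r c = some ⟨i, true⟩ ∧
        entry? T r' c' = some ⟨i + 1, true⟩ ∧ c < c') ∨
    (∃ r c r' c', entry? T r c = some ⟨i, false⟩ ∧
        entry? T r' c' = some ⟨i + 1, true⟩))}

/-! ## Dual equivalence operators on standard shifted tableaux -/

def numPrimes (T : STab) : ℕ := T.flatten.countP (fun x => x.primed)

/-- The entries of column `c`, read from bottom to top (increasing). -/
def colLetters (T : STab) (c : ℕ) : PWord :=
  (List.range (c + 1)).filterMap (fun r => entry? T r c)

/-- The shifted reading word `unprime(C_q R_q ⋯ C_1 R_1)`. -/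
def shword (T : STab) : List ℤ :=
  (((List.range (numCols T)).reverse).flatMap (fun idx =>
    (colLetters T idx).filter (fun x => x.primed) ++
      ((T.getD idx []).filter (fun x => !x.primed)))).map Letter.ceil

def idxOfZ (v : ℤ) : List ℤ → ℕ
  | [] => 0
  | x :: r => if x = v then 0 else idxOfZ v r + 1

def positionsOf (T : STab) : List (ℕ × ℕ) :=
  (List.range T.length).flatMap (fun r =>
    (List.range (T.getD r []).length).map (fun k => (r, r + k)))

/-- The box `□_v` of `T` containing `v` or `v'`. -/
def boxOf (T : STab) (v : ℤ) : Option (ℕ × ℕ) :=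
  (positionsOf T).find? (fun p =>
    match entry? T p.1 p.2 with
    | some x => decide (x.ceil = v)
    | none => false)

/-- Reverse the prime of the entry in position `(r, c)`. -/
def togglePos (T : STab) (r c : ℕ) : STab :=
  match entry? T r c with
  | some x => setEntryG T r c ⟨x.ceil, !x.primed⟩
  | none => T

/-- Switch the primes of the entries in the two given positions. -/
def switchAt (T : STab) (p q : ℕ × ℕ) : STab :=
  match entry? T p.1 p.2, entry? T q.1 q.2 with
  | some x, some y =>
      if x.primed = y.primed then T else togglePos (togglePos T p.1 p.2) q.1 q.2
  | _, _ => T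

/-- The row index of `□_v` if it is a main-diagonal box. -/
def diagBox? (T : STab) (v : ℤ) : Option ℕ :=
  (boxOf T v).bind (fun p => if p.1 = p.2 then some p.1 else none)

def switchDiag (T T' : STab) (u v : ℤ) : STab :=
  match diagBox? T u, diagBox? T v with
  | some r, some s => switchAt T' (r, r) (s, s)
  | _, _ => T'

/-- The operator `𝔰_i`. -/
def sOp (i : ℤ) (T : STab) : STab :=
  match boxOf T i, boxOf T (i + 1) with
  | some (r1, c1), some (r2, c2) =>
      if r1 ≠ r2 ∧ c1 ≠ c2 then
        -- swap i ↔ i+1 and i' ↔ (i+1)'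
        setEntryG (setEntryG T r1 c1 ⟨i + 1, ((entry? T r1 c1).getD default).primed⟩)
          r2 c2 ⟨i, ((entry? T r2 c2).getD default).primed⟩
      else if r1 ≠ c1 ∧ r2 ≠ c2 then
        -- same row or column, neither box diagonal: reverse both primes
        togglePos (togglePos T r1 c1) r2 c2
      else
        -- same row or column, one box diagonal
        let T1 := if r1 = c1 then togglePos T r2 c2 else togglePos T r1 c1
        let T2 :=
          if 1 ≤ i - 1 ∧ (diagBox? T (i - 1)).isSome ∧ (diagBox? T (i + 1)).isSome then
            switchDiag T T1 (i - 1) (i + 1)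
          else T1
        if i + 2 ≤ (T.flatten.length : ℤ) ∧ (diagBox? T i).isSome ∧
            (diagBox? T (i + 2)).isSome then
          switchDiag T T2 i (i + 2)
        else T2
  | _, _ => T

def btwn (a m b : ℕ) : Prop := (a < m ∧ m < b) ∨ (b < m ∧ m < a)

instance (a m b : ℕ) : Decidable (btwn a m b) := by unfold btwn; infer_instance

/-- The dual equivalence operator `𝔡_i` for `i ∈ ℤ`. -/
def dOp (i : ℤ) (T : STab) : STab :=
  if ¬(1 ≤ i + 2 ∧ i + 2 ≤ (T.flatten.length : ℤ)) then T
  else if i = -1 then togglePos T 0 0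
  else if i = 0 then togglePos T 0 1
  else
    let w := shword T
    if btwn (idxOfZ i w) (idxOfZ (i + 2) w) (idxOfZ (i + 1) w) then sOp i T
    else if btwn (idxOfZ (i + 1) w) (idxOfZ i w) (idxOfZ (i + 2) w) then sOp (i + 1) T
    else T

/-! ## Marked cycles -/

/-- The 2-cycles of `z`, as ordered pairs `(i, j)` with `i < j = z(i)`. -/
def cycSet (z : Equiv.Perm ℤ) : Set (ℤ × ℤ) := {p | p.1 < p.2 ∧ z p.1 = p.2}

/-- `s_{a_n} ⋯ s_{a_{k+2}} s_{a_{k+1}}` (ordinary product; 0-based index `k`). -/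
def suffixPerm (a : List ℤ) (k : ℕ) : Equiv.Perm ℤ :=
  ((a.drop (k + 1)).reverse.map sPerm).prod

/-- `γ_{k+1}(a)` as an ordered pair (junk value `(0,0)` off the commutation set). -/
def gammaPair (a : List ℤ) (k : ℕ) : ℤ × ℤ :=
  match a[k]? with
  | some x => (min (suffixPerm a k x) (suffixPerm a k (x + 1)),
               max (suffixPerm a k x) (suffixPerm a k (x + 1)))
  | none => (0, 0)
/-! ## Increasing factorization sequences and Schur Q-functions -/

/-- `Incr_∞(R_inv^+(z))`: sequences of weakly increasing primed words, all but
finitely many empty, whose concatenation is a primed involution word for `z`. -/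
def IncrSeq (z : Equiv.Perm ℤ) : Set (ℕ → PWord) :=
  {φ | (∀ n, List.Chain' (· ≤ ·) (φ n)) ∧
    ∃ N, (∀ n, N ≤ n → φ n = []) ∧ ((List.range N).map φ).flatten ∈ RinvPlus z}

/-- Least bound past which a sequence of words is empty. -/
noncomputable def seqBound (φ : ℕ → PWord) : ℕ := sInf {N | ∀ n, N ≤ n → φ n = []}

/-- The concatenation `a^1 a^2 ⋯` of a sequence of words. -/
noncomputable def concatSeq (φ : ℕ → PWord) : PWord :=
  ((List.range (seqBound φ)).map φ).flatten

/-- `ℓ(a^1) + ⋯ + ℓ(a^i)`. -/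
def prefLen (φ : ℕ → PWord) (i : ℕ) : ℕ := (((List.range i).map φ).map List.length).sum

/-- The minimal `i ≥ 1` with `j ≤ ℓ(a^1) + ⋯ + ℓ(a^i)`. -/
noncomputable def relabel (φ : ℕ → PWord) (j : ℤ) : ℤ :=
  ((sInf {i : ℕ | 1 ≤ i ∧ j ≤ (prefLen φ i : ℤ)} : ℕ) : ℤ)

/-- The semistandard recording tableau `Q_EGᴼ(φ)`. -/
noncomputable def QEGseq (φ : ℕ → PWord) : STab :=
  (QEG (concatSeq φ)).map (List.map (fun x => (⟨relabel φ x.ceil, x.primed⟩ : Letter)))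

/-- The insertion tableau `P_EGᴼ(φ)`. -/
noncomputable def PEGseq (φ : ℕ → PWord) : STab := PEG (concatSeq φ)

/-- The Schur Q-function of a strict partition: the coefficient of the monomial with
exponent vector `d` is the number of semistandard shifted tableaux `T` of the given
shape with `x^T = x^d`. -/
noncomputable def SchurQ (sh : List ℕ) : MvPowerSeries ℤ ℤ :=
  fun d => (({T : STab | shapeOf T = sh ∧ IsSemistandard T ∧
    ∀ i : ℤ, d i = T.flatten.countP (fun x => decide (x.ceil = i))} : Set STab).ncard : ℤ)

/-- `Q_z = Σ_{φ ∈ Incr_∞(R_inv^+(z))} x^φ`. -/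
noncomputable def Qz (z : Equiv.Perm ℤ) : MvPowerSeries ℤ ℤ :=
  fun d => (({φ : ℕ → PWord | φ ∈ IncrSeq z ∧
    (∀ i : ℕ, d ((i : ℤ) + 1) = (φ i).length) ∧
    (∀ j : ℤ, j ≤ 0 → d j = 0)} : Set (ℕ → PWord)).ncard : ℤ)

/-! ## Dominant involutions -/

/-- The shifted diagram `SD_λ ⊆ ℤ × ℤ` of a strict partition. -/
def SDset (sh : List ℕ) : Set (ℤ × ℤ) :=
  {p | ∃ i j : ℕ, 1 ≤ i ∧ i ≤ sh.length ∧ 1 ≤ j ∧ j ≤ sh.getD (i - 1) 0 ∧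
    p.1 = (i : ℤ) ∧ p.2 = (i : ℤ) + (j : ℤ) - 1}

/-- The involution Rothe diagram `D̂(z) = {(i,j) : z(i) > j ≤ i < z(j)}`. -/
def invRothe (z : Equiv.Perm ℤ) : Set (ℤ × ℤ) :=
  {p | p.2 < z p.1 ∧ p.2 ≤ p.1 ∧ p.1 < z p.2}

/-- The tableau `T_λ` with entry `i + j - 1` in box `(i, j)` of `SD_λ`. -/
def Tlam (sh : List ℕ) : STab :=
  (List.range sh.length).map (fun r =>
    (List.range (sh.getD r 0)).map (fun k =>
      (⟨2 * (r : ℤ) + (k : ℤ) + 1, false⟩ : Letter)))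

/-- The permutation `i + m ↦ w(i) + m` (fixing everything outside `m + support`). -/
def shiftPerm (m : ℕ) (w : Equiv.Perm ℤ) : Equiv.Perm ℤ :=
  (Equiv.addLeft (m : ℤ)).permCongr w

/-- `z ∈ S_m`: `z` fixes every point outside `[1, m]`. -/
def SupportedOn (z : Equiv.Perm ℤ) (m : ℕ) : Prop :=
  ∀ x : ℤ, x < 1 ∨ (m : ℤ) < x → z x = x
/-! ## Primed compatible sequences -/

/-- A primed compatible sequence, recorded as the list of its columns `(index; value)`. -/
def IsPrimedCompatible (φ : List (ℕ × Letter)) : Prop :=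
  (∀ p ∈ φ, 0 < p.1 ∧ 0 < p.2.ceil) ∧
  List.Chain' (fun p q : ℕ × Letter => p.1 ≤ q.1 ∧ (p.1 = q.1 → p.2 ≤ q.2)) φ ∧
  (∀ (k l : ℕ) (p : ℕ × Letter), k < l → φ[k]? = some p → φ[l]? = some p →
    p.2.primed = false)

def IsIndexStrict (φ : List (ℕ × Letter)) : Prop :=
  List.Chain' (fun p q : ℕ × Letter => p.1 < q.1) φ

/-! ## Sagan–Worley insertion (orthogonal and symplectic versions) -/

/-- Whether `u` bumps `v`: strict comparison when inserting an unprimed letter into a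
row or a primed letter into a column, weak comparison otherwise. -/
def swBump (isRow : Bool) (u v : Letter) : Bool :=
  if (isRow && !u.primed) || (!isRow && u.primed) then decide (u < v) else decide (u ≤ v)

/-- Column stage of orthogonal Sagan–Worley insertion. -/
def swColO : ℕ → STab → ℕ → Letter → STab × Bool
  | 0, T, _, _ => (T, true)
  | fuel + 1, T, c, u =>
    let occ := (List.range (c + 1)).filterMap (fun r => (entry? T r c).map (fun x => (r, x)))
    match occ.find? (fun p => swBump false u p.2) with
    | none =>
        let r := occ.length
        let u' := if r = c ∧ u.primed then Letter.unprime u else u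
        (setRowG T r ((T.getD r []) ++ [u']), true)
    | some p =>
        if p.1 = c then
          if u.ceil = p.2.ceil then swColO fuel T (c + 1) (Letter.unprime p.2)
          else
            let q := switchPrimes u p.2
            swColO fuel (setEntryG T p.1 c q.1) (c + 1) q.2
        else swColO fuel (setEntryG T p.1 c u) (c + 1) p.2

/-- Row stage of orthogonal Sagan–Worley insertion. -/
def swRowO : ℕ → STab → ℕ → Letter → STab × Bool
  | 0, T, _, _ => (T, true)
  | fuel + 1, T, r, u =>
    let row := T.getD r []
    match row.findIdx? (fun v => swBump true u v) with
    | none =>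
        if row.isEmpty ∧ u.primed then (setRowG T r [Letter.unprime u], true)
        else (setRowG T r (row ++ [u]), false)
    | some k =>
        let v := row.getD k default
        if k = 0 then
          if u.ceil = v.ceil then swColO fuel T (r + 1) (Letter.unprime v)
          else
            let q := switchPrimes u v
            swColO fuel (setRowG T r (row.set 0 q.1)) (r + 1) q.2
        else swRowO fuel (setRowG T r (row.set k u)) (r + 1) v

def swInsertO (T : STab) (u : Letter) : STab × Bool :=
  swRowO (T.flatten.length + T.length + 2) T 0 u

/-- Column stage of symplectic (original) Sagan–Worley insertion. -/
def swColSp : ℕ → STab → ℕ → Letter → STab × Bool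
  | 0, T, _, _ => (T, true)
  | fuel + 1, T, c, u =>
    let occ := (List.range (c + 1)).filterMap (fun r => (entry? T r c).map (fun x => (r, x)))
    match occ.find? (fun p => swBump false u p.2) with
    | none => (setRowG T occ.length ((T.getD occ.length []) ++ [u]), true)
    | some p =>
        if p.1 = c then
          if u.ceil = p.2.ceil then swColSp fuel T (c + 1) (Letter.unprime p.2)
          else swColSp fuel (setEntryG T p.1 c u) (c + 1) p.2
        else swColSp fuel (setEntryG T p.1 c u) (c + 1) p.2

/-- Row stage of symplectic (original) Sagan–Worley insertion. -/
def swRowSp : ℕ → STab → ℕ → Letter → STab × Bool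
  | 0, T, _, _ => (T, true)
  | fuel + 1, T, r, u =>
    let row := T.getD r []
    match row.findIdx? (fun v => swBump true u v) with
    | none => (setRowG T r (row ++ [u]), false)
    | some k =>
        let v := row.getD k default
        if k = 0 then
          if u.ceil = v.ceil then swColSp fuel T (r + 1) (Letter.unprime v)
          else swColSp fuel (setRowG T r (row.set 0 u)) (r + 1) v
        else swRowSp fuel (setRowG T r (row.set k u)) (r + 1) v

def swInsertSp (T : STab) (u : Letter) : STab × Bool :=
  swRowSp (T.flatten.length + T.length + 2) T 0 u

def PSWO (φ : List (ℕ × Letter)) : STab := φ.foldl (fun T p => (swInsertO T p.2).1) []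

def PSWSp (φ : List (ℕ × Letter)) : STab := φ.foldl (fun T p => (swInsertSp T p.2).1) []

def QSWaux (ins : STab → Letter → STab × Bool) : STab → STab → List (ℕ × Letter) → STab
  | _, Q, [] => Q
  | P, Q, p :: rest =>
      let res := ins P p.2
      QSWaux ins res.1 (addBox Q P res.1 ⟨(p.1 : ℤ), res.2⟩) rest

def QSWO (φ : List (ℕ × Letter)) : STab := QSWaux swInsertO [] [] φ

def QSWSp (φ : List (ℕ × Letter)) : STab := QSWaux swInsertSp [] [] φ

/-- Entry `A_{ij}` of the circled matrix of `φ` (forgetting the circles). -/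
def cmEntry (φ : List (ℕ × Letter)) (i j : ℕ) : ℕ :=
  φ.countP (fun p => decide (p.1 = i ∧ p.2.ceil = (j : ℤ)))

/-! ## Shifted mixed insertion (orthogonal and symplectic versions) -/

/-- Tableaux whose entries are signed letters `(ε, u)`, `ε ∈ {+, -}`
(`true` records the sign `-`). -/
abbrev MTab := List (List (Bool × Letter))

def extractO (U : MTab) : STab :=
  U.map (fun row =>
    match row with
    | [] => []
    | (e, x) :: rest => (if e then (⟨x.ceil, true⟩ : Letter) else x) :: rest.map Prod.snd)

def extractSp (U : MTab) : STab := U.map (List.map Prod.snd)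

/-- One mixed insertion, of the pair `β` into row (`isCol = false`) or column
(`isCol = true`) number `idx`; returns the tableau and the added box. -/
def hmIns (sympl : Bool) : ℕ → MTab → Bool → ℕ → Bool × Letter → MTab × (ℕ × ℕ)
  | 0, T, _, _, _ => (T, (0, 0))
  | fuel + 1, T, isCol, idx, β =>
    if isCol then
      let c := idx
      let occ := (List.range (c + 1)).filterMap
        (fun r => (entryG? T r c).map (fun x => (r, x)))
      match occ.find? (fun p => decide (β.2 < p.2.2)) with
      | none =>
          let r := occ.length
          (setRowG T r ((T.getD r []) ++ [β]), (r, c))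
      | some p =>
          if p.1 = c then
            hmIns sympl fuel
              (setEntryG T p.1 c (if sympl then (p.2.1, β.2) else β)) true (c + 1)
              (if sympl then (β.1, ⟨p.2.2.ceil, true⟩) else (p.2.1, ⟨p.2.2.ceil, true⟩))
          else
            hmIns sympl fuel (setEntryG T p.1 c (p.2.1, β.2)) p.2.2.primed
              (if p.2.2.primed then c + 1 else p.1 + 1) (β.1, p.2.2)
    else
      let r := idx
      let row := T.getD r []
      match row.findIdx? (fun p => decide (β.2 < p.2)) with
      | none => (setRowG T r (row ++ [β]), (r, r + row.length))
      | some k =>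
          let q := row.getD k default
          if k = 0 then
            hmIns sympl fuel
              (setRowG T r (row.set 0 (if sympl then (q.1, β.2) else β))) true (r + 1)
              (if sympl then (β.1, ⟨q.2.ceil, true⟩) else (q.1, ⟨q.2.ceil, true⟩))
          else
            hmIns sympl fuel (setRowG T r (row.set k (q.1, β.2))) q.2.primed
              (if q.2.primed then r + k + 1 else r + 1) (β.1, q.2)

def hmInsert (sympl : Bool) (T : MTab) (x : Letter) : MTab × (ℕ × ℕ) :=
  hmIns sympl (2 * T.flatten.length + 4) T false 0 (x.primed, ⟨x.ceil, false⟩)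

def hmAuxCS (sympl : Bool) : MTab → STab → List (ℕ × Letter) → MTab × STab
  | U, Q, [] => (U, Q)
  | U, Q, p :: rest =>
      let res := hmInsert sympl U p.2
      let pos := res.2
      let sgn := ((entryG? res.1 pos.1 pos.2).map Prod.fst).getD false
      let pr : Bool := if sympl then sgn else (decide (pos.1 ≠ pos.2) && sgn)
      hmAuxCS sympl res.1
        (setRowG Q pos.1 ((Q.getD pos.1 []) ++ [(⟨(p.1 : ℤ), pr⟩ : Letter)])) rest

def PHMO (φ : List (ℕ × Letter)) : STab := extractO (hmAuxCS false [] [] φ).1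
def QHMO (φ : List (ℕ × Letter)) : STab := (hmAuxCS false [] [] φ).2
def PHMSp (φ : List (ℕ × Letter)) : STab := extractSp (hmAuxCS true [] [] φ).1
def QHMSp (φ : List (ℕ × Letter)) : STab := (hmAuxCS true [] [] φ).2

/-- A primed word, identified with the primed compatible sequence with
index row `1, 2, …, n`. -/
def wordCS (a : PWord) : List (ℕ × Letter) :=
  ((List.range a.length).zip a).map (fun p => (p.1 + 1, p.2))

/-! ## The transpose of a primed compatible sequence -/

def insSortedCS (p : ℕ × Letter) : List (ℕ × Letter) → List (ℕ × Letter)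
  | [] => [p]
  | q :: rest =>
      if p.1 < q.1 ∨ (p.1 = q.1 ∧ p.2 ≤ q.2) then p :: q :: rest
      else q :: insSortedCS p rest

def sortCS (l : List (ℕ × Letter)) : List (ℕ × Letter) := l.foldr insSortedCS []

/-- `φ^⊤`: move each prime from the value to the index above it, interchange the two
rows, and reorder the columns lexicographically. -/
def transposeCS (φ : List (ℕ × Letter)) : List (ℕ × Letter) :=
  sortCS (φ.map (fun p => (p.2.ceil.toNat, (⟨(p.1 : ℤ), p.2.primed⟩ : Letter))))

namespace ShiftedDuality

open Function

/-! ### Shifted shapes and their addable corners -/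

/-- A tableau as a partial function on cells `(row, column)`. -/
abbrev FTab (α : Type) := ℕ × ℕ → Option α

def dom {α : Type} (F : FTab α) : Set (ℕ × ℕ) := {b | F b ≠ none}

theorem dom_update {α : Type} (F : FTab α) (b : ℕ × ℕ) (x : α) :
    dom (update F b (some x)) = insert b (dom F) := by
  ext a
  by_cases h : a = b
  · subst h; simp [dom]
  · simp [dom, h]

theorem mem_dom {α : Type} {F : FTab α} {b : ℕ × ℕ} {x : α} (h : F b = some x) : b ∈ dom F := by
  simp [dom, h]

theorem dom_update_of_mem {α : Type} {F : FTab α} {b : ℕ × ℕ} (x : α) (h : b ∈ dom F) :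
    dom (update F b (some x)) = dom F := by
  rw [dom_update, Set.insert_eq_of_mem h]

/-- The cell set of a shifted diagram. -/
structure IsShape (S : Set (ℕ × ℕ)) : Prop where
  le : ∀ r c, (r, c) ∈ S → r ≤ c
  mono : ∀ r c r' c', (r, c) ∈ S → r' ≤ r → c' ≤ c → r' ≤ c' → (r', c') ∈ S
  bdd : ∃ N, ∀ r c, (r, c) ∈ S → c < N

/-- `b` can be added at the end of both its row and its column. -/
structure Corner (S : Set (ℕ × ℕ)) (b : ℕ × ℕ) : Prop where
  le : b.1 ≤ b.2
  row : ∀ c, (b.1, c) ∈ S ↔ b.1 ≤ c ∧ c < b.2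
  col : ∀ r, (r, b.2) ∈ S ↔ r < b.1

theorem Corner.notMem {S : Set (ℕ × ℕ)} {b : ℕ × ℕ} (h : Corner S b) : b ∉ S := by
  intro hb
  have := (h.row b.2).1 hb
  omega

theorem Corner.eq_of_row {S : Set (ℕ × ℕ)} {b B : ℕ × ℕ} (h : Corner S b) (H : Corner S B)
    (e : b.1 = B.1) : b = B := by
  refine Prod.ext e ?_
  have h1 := h.row B.2
  have h2 := H.row b.2
  have := h.le
  have := H.le
  rw [e] at h1
  rw [← e] at h2
  have h3 := h.notMem
  have h4 := H.notMem
  have e1 : (b.1, b.2) = b := rfl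
  have e2 : (B.1, B.2) = B := rfl
  rw [e1] at h2
  rw [e2] at h1
  simp only [h3, h4, false_iff] at h1 h2
  omega

theorem Corner.eq_of_col {S : Set (ℕ × ℕ)} {b B : ℕ × ℕ} (h : Corner S b) (H : Corner S B)
    (e : b.2 = B.2) : b = B := by
  refine Prod.ext ?_ e
  have h1 := h.col B.1
  have h2 := H.col b.1
  rw [e] at h1
  rw [← e] at h2
  have h3 := h.notMem
  have h4 := H.notMem
  have e1 : (b.1, b.2) = b := rfl
  have e2 : (B.1, B.2) = B := rfl
  rw [e1] at h2
  rw [e2] at h1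
  simp only [h3, h4, false_iff] at h1 h2
  omega

theorem Corner.insert_other {S : Set (ℕ × ℕ)} {b B : ℕ × ℕ} (h : Corner S b) (H : Corner S B)
    (ne : b ≠ B) : Corner (insert B S) b := by
  refine ⟨h.le, fun c => ?_, fun r => ?_⟩
  · rw [Set.mem_insert_iff, h.row]
    refine ⟨fun h1 => h1.resolve_left fun h2 => ne (h.eq_of_row H ?_), Or.inr⟩
    rw [← h2]
  · rw [Set.mem_insert_iff, h.col]
    refine ⟨fun h1 => h1.resolve_left fun h2 => ne (h.eq_of_col H ?_), Or.inr⟩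
    rw [← h2]

theorem IsShape.insert {S : Set (ℕ × ℕ)} {b : ℕ × ℕ} (hS : IsShape S) (h : Corner S b) :
    IsShape (insert b S) := by
  obtain ⟨r0, c0⟩ := b
  have hle := h.le
  have hrow := h.row
  have hcol := h.col
  simp only at hle hrow hcol
  refine ⟨?_, ?_, ?_⟩
  · rintro r c (h1 | h1)
    · cases h1; exact hle
    · exact hS.le _ _ h1
  · rintro r c r' c' (h1 | h1) hr hc hrc
    · cases h1
      rcases Nat.eq_or_lt_of_le hr with rfl | hr
      · rcases Nat.eq_or_lt_of_le hc with rfl | hc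
        · exact Or.inl rfl
        · exact Or.inr ((hrow c').2 ⟨hrc, hc⟩)
      · exact Or.inr (hS.mono _ _ _ _ ((hcol r').2 hr) le_rfl hc hrc)
    · exact Or.inr (hS.mono _ _ _ _ h1 hr hc hrc)
  · obtain ⟨N, hN⟩ := hS.bdd
    refine ⟨max N (c0 + 1), ?_⟩
    rintro r c (h1 | h1)
    · cases h1; omega
    · have := hN _ _ h1; omega

theorem isShape_empty : IsShape ∅ := ⟨by simp, by simp, ⟨0, by simp⟩⟩

theorem IsShape.exists_row_end {S : Set (ℕ × ℕ)} (hS : IsShape S) (r : ℕ) :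
    ∃ z, r ≤ z ∧ (r, z) ∉ S ∧ ∀ c, (r, c) ∈ S ↔ r ≤ c ∧ c < z := by
  classical
  obtain ⟨N, hN⟩ := hS.bdd
  have hex : ∃ z, r ≤ z ∧ (r, z) ∉ S :=
    ⟨max N r, le_max_right _ _, fun h => absurd (hN _ _ h) (by simp)⟩
  refine ⟨Nat.find hex, (Nat.find_spec hex).1, (Nat.find_spec hex).2, fun c => ⟨fun h => ?_, ?_⟩⟩
  · refine ⟨hS.le _ _ h, ?_⟩
    by_contra hc
    exact (Nat.find_spec hex).2 (hS.mono _ _ _ _ h le_rfl (by omega) (Nat.find_spec hex).1)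
  · rintro ⟨h1, h2⟩
    have := Nat.find_min hex h2
    simp only [h1, true_and, not_not] at this
    exact this

theorem IsShape.exists_col_end {S : Set (ℕ × ℕ)} (hS : IsShape S) (c : ℕ) :
    ∃ z, (z, c) ∉ S ∧ ∀ r, (r, c) ∈ S ↔ r < z := by
  classical
  have hex : ∃ z, (z, c) ∉ S := ⟨c + 1, fun h => absurd (hS.le _ _ h) (by simp)⟩
  refine ⟨Nat.find hex, Nat.find_spec hex, fun r => ⟨fun h => ?_, fun h => ?_⟩⟩
  · by_contra hc
    have := hS.le _ _ h
    exact Nat.find_spec hex (hS.mono _ _ _ _ h (by omega) le_rfl (by omega))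
  · exact not_not.1 (Nat.find_min hex h)

theorem IsShape.exists_corner_zero {S : Set (ℕ × ℕ)} (hS : IsShape S) :
    ∃ c, Corner S (0, c) := by
  obtain ⟨z, hz, hn, h⟩ := hS.exists_row_end 0
  exact ⟨z, hz, h, fun r => ⟨fun hr => absurd (hS.mono _ _ _ _ hr (Nat.zero_le _) le_rfl hz) hn,
    fun hr => absurd hr (Nat.not_lt_zero _)⟩⟩

/-- `B'` lies in the next column (`d = true`) or the next row (`d = false`) after `B`. -/
def NextTo (d : Bool) (B B' : ℕ × ℕ) : Prop :=
  bif d then B'.2 = B.2 + 1 ∧ B'.1 ≤ B.1 else B'.1 = B.1 + 1 ∧ B'.2 ≤ B.2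

theorem IsShape.exists_next {S : Set (ℕ × ℕ)} (hS : IsShape S) {B : ℕ × ℕ} (h : Corner S B)
    (d : Bool) (hd : d = false → B.1 ≠ B.2) :
    ∃ B', NextTo d B B' ∧ Corner (Insert.insert B S) B' := by
  have hT := hS.insert h
  obtain ⟨r, c⟩ := B
  have hle := h.le
  have hrow := h.row
  have hcol := h.col
  simp only at hle hrow hcol hd
  cases d with
  | true =>
    obtain ⟨z, hn, hz⟩ := hT.exists_col_end (c + 1)
    have hzr : z ≤ r := by
      by_contra hcon
      have : (r, c + 1) ∈ Insert.insert (r, c) S := (hz r).2 (by omega)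
      rcases this with h1 | h1
      · simp at h1
      · have := (hrow (c + 1)).1 h1; omega
    refine ⟨(z, c + 1), ⟨rfl, hzr⟩, by simp only; omega, fun c' => ?_, hz⟩
    simp only
    refine ⟨fun h1 => ⟨hT.le _ _ h1, ?_⟩, fun h1 => ?_⟩
    · by_contra hcon
      exact hn (hT.mono _ _ _ _ h1 le_rfl (by omega) (by omega))
    · exact hT.mono _ _ _ _ (Set.mem_insert (r, c) S) hzr (by omega) h1.1
  | false =>
    have hd := hd rfl
    obtain ⟨z, hz0, hn, hz⟩ := hT.exists_row_end (r + 1)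
    have hzc : z ≤ c := by
      by_contra hcon
      have : (r + 1, c) ∈ Insert.insert (r, c) S := (hz c).2 (by omega)
      rcases this with h1 | h1
      · simp at h1
      · have := (hcol (r + 1)).1 h1; omega
    refine ⟨(r + 1, z), ⟨rfl, hzc⟩, hz0, hz, fun r' => ?_⟩
    simp only
    refine ⟨fun h1 => ?_, fun h1 => ?_⟩
    · by_contra hcon
      exact hn (hT.mono _ _ _ _ h1 (by omega) le_rfl hz0)
    · exact hT.mono _ _ _ _ (Set.mem_insert (r, c) S) (by omega) hzc (by omega)

/-- The `i`-th cell of column `idx` (`d = true`) or row `idx` (`d = false`). -/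
def lineBox (d : Bool) (idx i : ℕ) : ℕ × ℕ := bif d then (i, idx) else (idx, i)

theorem lineBox_inj {d : Bool} {idx i j : ℕ} (h : lineBox d idx i = lineBox d idx j) : i = j := by
  cases d <;> simp_all [lineBox]

theorem lineBox_diag (d : Bool) (idx i : ℕ) :
    (lineBox d idx i).1 = (lineBox d idx i).2 ↔ i = idx := by
  cases d <;> simp [lineBox, eq_comm]

theorem Corner.line_eq {S : Set (ℕ × ℕ)} {d : Bool} {idx i j : ℕ}
    (h : Corner S (lineBox d idx i)) (H : Corner S (lineBox d idx j)) :
    lineBox d idx i = lineBox d idx j := by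
  cases d
  · exact h.eq_of_row H rfl
  · exact h.eq_of_col H rfl

theorem Corner.lt_of_mem {S : Set (ℕ × ℕ)} {d : Bool} {idx i j : ℕ}
    (h : Corner S (lineBox d idx i)) (H : lineBox d idx j ∈ S) : j < i := by
  cases d
  · exact ((h.row j).1 H).2
  · exact (h.col j).1 H

/-! ### Sagan–Worley insertion as a relation -/

def onDiag (b : ℕ × ℕ) : Bool := decide (b.1 = b.2)

/-- The letter recorded when `u` is added in the cell `b`. -/
def place (sp : Bool) (b : ℕ × ℕ) (u : Letter) : Letter :=
  bif !sp && onDiag b then u.unprime else u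

def diagSwap (sp : Bool) (u v : Letter) : Letter × Letter :=
  bif sp then (u, v) else switchPrimes u v

theorem diagSwap_ceil (sp : Bool) (u v : Letter) :
    (diagSwap sp u v).1.ceil = u.ceil ∧ (diagSwap sp u v).2.ceil = v.ceil := by
  cases sp
  · simp only [diagSwap, switchPrimes, cond_false]
    split <;> simp
  · simp [diagSwap]

/-- `SW sp k d idx F u F' B fl`: inserting `u` into column (`d = true`) or row `idx` of `F`
takes `k` stages, gives `F'`, adds the cell `B`, and ends in column insertion iff `fl`. -/
inductive SW (sp : Bool) :
    ℕ → Bool → ℕ → FTab Letter → Letter → FTab Letter → ℕ × ℕ → Bool → Prop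
  | terminal {d : Bool} {idx i : ℕ} {F : FTab Letter} {u : Letter}
      (hB : Corner (dom F) (lineBox d idx i)) (hd : d = true → i ≠ idx)
      (hlt : ∀ j v, F (lineBox d idx j) = some v → v.ceil < u.ceil) :
      SW sp 1 d idx F u (update F (lineBox d idx i) (some (place sp (lineBox d idx i) u)))
        (lineBox d idx i) (d || (!sp && onDiag (lineBox d idx i) && u.primed))
  | off {k : ℕ} {d : Bool} {idx i : ℕ} {F : FTab Letter} {u v : Letter} {F' : FTab Letter}
      {B : ℕ × ℕ} {fl : Bool} (hi : i ≠ idx) (hv : F (lineBox d idx i) = some v)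
      (huv : u.ceil < v.ceil)
      (hlt : ∀ j w, j < i → F (lineBox d idx j) = some w → w.ceil < u.ceil)
      (h : SW sp k d (idx + 1) (update F (lineBox d idx i) (some u)) v F' B fl) :
      SW sp (k + 1) d idx F u F' B fl
  | diag {k : ℕ} {idx : ℕ} {F : FTab Letter} {u v : Letter} {F' : FTab Letter}
      {B : ℕ × ℕ} {fl : Bool} (hv : F (idx, idx) = some v) (huv : u.ceil < v.ceil)
      (h : SW sp k true (idx + 1) (update F (idx, idx) (some (diagSwap sp u v).1))
        (diagSwap sp u v).2 F' B fl) :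
      SW sp (k + 1) false idx F u F' B fl

theorem SW.corner {sp : Bool} {k : ℕ} {d : Bool} {idx : ℕ} {F F' : FTab Letter} {u : Letter}
    {B : ℕ × ℕ} {fl : Bool} (h : SW sp k d idx F u F' B fl) :
    Corner (dom F) B ∧ dom F' = insert B (dom F) := by
  induction h with
  | terminal hB hd hlt => exact ⟨hB, dom_update _ _ _⟩
  | off hi hv huv hlt h ih => rwa [dom_update_of_mem _ (mem_dom hv)] at ih
  | diag hv huv h ih => rwa [dom_update_of_mem _ (mem_dom hv)] at ih

theorem place_ceil (sp : Bool) (b : ℕ × ℕ) (u : Letter) : (place sp b u).ceil = u.ceil := by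
  unfold place
  cases !sp && onDiag b <;> simp [Letter.unprime]

theorem SW.forall_ceil {sp : Bool} {k : ℕ} {d : Bool} {idx : ℕ} {F F' : FTab Letter} {u : Letter}
    {B : ℕ × ℕ} {fl : Bool} (h : SW sp k d idx F u F' B fl) (p : ℤ → Prop)
    (hF : ∀ b v, F b = some v → p v.ceil) (hu : p u.ceil) :
    ∀ b v, F' b = some v → p v.ceil := by
  induction h with
  | terminal hB hd hlt =>
    intro b v hb
    rw [update_apply] at hb
    split at hb
    · cases hb; rwa [place_ceil]
    · exact hF _ _ hb
  | off hi hv huv hlt h ih =>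
    refine ih (fun b w hb => ?_) (hF _ _ hv)
    rw [update_apply] at hb
    split at hb
    · cases hb; exact hu
    · exact hF _ _ hb
  | diag hv huv h ih =>
    refine ih (fun b w hb => ?_) ?_
    · rw [update_apply] at hb
      split at hb
      · cases hb; rwa [(diagSwap_ceil _ _ _).1]
      · exact hF _ _ hb
    · rw [(diagSwap_ceil _ _ _).2]; exact hF _ _ hv

theorem update_line_ne {α : Type} {F : FTab α} {d : Bool} {idx i j : ℕ} {b : ℕ × ℕ} {m v w : α}
    (hb : Corner (dom F) b) (hv : F (lineBox d idx i) = some v) (hj : j < i)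
    (hw : update F b (some m) (lineBox d idx j) = some w) : F (lineBox d idx j) = some w := by
  rwa [update_of_ne] at hw
  rintro rfl
  have := hb.lt_of_mem (mem_dom hv)
  omega

theorem update_line_end {α : Type} {F : FTab α} {d : Bool} {idx i j : ℕ} {b : ℕ × ℕ} {m w : α}
    (hb : Corner (dom F) b) (hB : Corner (dom F) (lineBox d idx i)) (hne : b ≠ lineBox d idx i)
    (hw : update F b (some m) (lineBox d idx j) = some w) : F (lineBox d idx j) = some w := by
  rwa [update_of_ne] at hw
  rintro rfl
  exact hne (hb.line_eq hB)

theorem update_mem {α : Type} {F : FTab α} {a b : ℕ × ℕ} {m v : α}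
    (hb : Corner (dom F) b) (hv : F a = some v) :
    a ≠ b ∧ update F b (some m) a = some v := by
  have h : a ≠ b := by rintro rfl; exact hb.notMem (mem_dom hv)
  exact ⟨h, by rwa [update_of_ne h]⟩

/-- Inserting is unaffected by an extra entry in a corner which is not reached. -/
theorem SW.add_other {sp : Bool} {k : ℕ} {d : Bool} {idx : ℕ} {F F' : FTab Letter} {u : Letter}
    {B : ℕ × ℕ} {fl : Bool} (h : SW sp k d idx F u F' B fl) {b : ℕ × ℕ} (m : Letter)
    (hb : Corner (dom F) b) (hne : b ≠ B) :
    SW sp k d idx (update F b (some m)) u (update F' b (some m)) B fl := by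
  induction h with
  | terminal hB hd hlt =>
    rw [update_comm hne.symm]
    refine SW.terminal ?_ hd fun j v hj => hlt j v (update_line_end hb hB hne hj)
    rw [dom_update]
    exact hB.insert_other hb hne.symm
  | off hi hv huv hlt h ih =>
    obtain ⟨hne', hv'⟩ := update_mem (m := m) hb hv
    refine SW.off hi hv' huv (fun j w hj hw => hlt j w hj (update_line_ne hb hv hj hw)) ?_
    rw [update_comm hne'.symm]
    exact ih (by rwa [dom_update_of_mem _ (mem_dom hv)]) hne
  | diag hv huv h ih =>
    obtain ⟨hne', hv'⟩ := update_mem (m := m) hb hv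
    refine SW.diag hv' huv ?_
    rw [update_comm hne'.symm]
    exact ih (by rwa [dom_update_of_mem _ (mem_dom hv)]) hne

theorem NextTo.lineBox {d : Bool} {idx i : ℕ} {B' : ℕ × ℕ} (h : NextTo d (lineBox d idx i) B') :
    ∃ i', B' = lineBox d (idx + 1) i' ∧ (d = true → i' ≤ i) := by
  obtain ⟨r, c⟩ := B'
  cases d
  · simp only [NextTo, ShiftedDuality.lineBox, cond_false] at h
    exact ⟨c, by simp [ShiftedDuality.lineBox, h.1], by simp⟩
  · simp only [NextTo, ShiftedDuality.lineBox, cond_true] at h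
    exact ⟨r, by simp [ShiftedDuality.lineBox, h.1], fun _ => h.2⟩

/-- If the cell added by an insertion carries a maximal letter, that letter is bumped to the
end of the next row or column. -/
theorem SW.add_hit {sp : Bool} {k : ℕ} {d : Bool} {idx : ℕ} {F F' : FTab Letter} {u : Letter}
    {B : ℕ × ℕ} {fl : Bool} (h : SW sp k d idx F u F' B fl) {M : ℤ} {e : Bool} {B' : ℕ × ℕ}
    (hF : ∀ b v, F b = some v → v.ceil < M) (hu : u.ceil < M)
    (hn : NextTo (fl || onDiag B) B B') (hB' : Corner (insert B (dom F)) B') :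
    SW sp (k + 1) d idx (update F B (some (place sp B ⟨M, e⟩))) u
      (update F' B' (some (place sp B' ⟨M, bif !sp && onDiag B then fl else e⟩))) B'
      ((fl || onDiag B) || (!sp && onDiag B' && (bif !sp && onDiag B then fl else e))) := by
  induction h with
  | @terminal d idx i F u hB hd hlt =>
    have hleB := hB.le
    by_cases hi : i = idx
    · have hdf : d = false := by
        cases d
        · rfl
        · exact absurd hi (hd rfl)
      subst hdf hi
      have hon : onDiag (lineBox false i i) = true := by simp [lineBox, onDiag]
      simp only [hon, Bool.and_true, Bool.or_true] at hn ⊢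
      obtain ⟨i', rfl, hi'⟩ : ∃ i', B' = lineBox true (i + 1) i' ∧ i' ≤ i := by
        obtain ⟨r, c⟩ := B'
        simp only [NextTo, lineBox, cond_true, cond_false] at hn
        exact ⟨r, by simp [lineBox, hn.1], hn.2⟩
      have hsw : diagSwap sp u (place sp (lineBox false i i) ⟨M, e⟩) =
          (place sp (lineBox false i i) u,
            ⟨M, bif !sp then (false || !sp && u.primed) else e⟩) := by
        obtain ⟨uc, up⟩ := u
        cases sp <;> cases up <;>
          simp [diagSwap, place, hon, switchPrimes, Letter.unprime]
      refine SW.diag (v := place sp (lineBox false i i) ⟨M, e⟩) (by simp [lineBox])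
        (by rw [place_ceil]; exact hu) ?_
      rw [hsw]
      have hst := SW.terminal (sp := sp) (d := true) (idx := i + 1) (i := i')
        (F := update F (lineBox false i i) (some (place sp (lineBox false i i) u)))
        (u := ⟨M, bif !sp then (false || !sp && u.primed) else e⟩)
        (by rwa [dom_update]) (fun _ => by omega) (fun j v hv => by
          rw [update_apply] at hv
          split at hv
          · cases hv; rw [place_ceil]; exact hu
          · exact hF _ _ hv)
      have e0 : ((i, i) : ℕ × ℕ) = lineBox false i i := rfl
      rw [e0, update_idem]
      simpa using hst
    · have hon : onDiag (lineBox d idx i) = false := by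
        simp [onDiag, lineBox_diag, hi]
      simp only [hon, Bool.and_false, Bool.or_false, Bool.false_and, cond_false] at hn ⊢
      obtain ⟨i', rfl, hi'⟩ := hn.lineBox
      have hpl : ∀ x, place sp (lineBox d idx i) x = x := by simp [place, hon]
      simp only [hpl]
      refine SW.off (i := i) (v := ⟨M, e⟩) hi (by simp) hu (fun j w hj hw => hlt j w ?_) ?_
      · rwa [update_of_ne] at hw
        exact fun h => by have := lineBox_inj h; omega
      · rw [update_idem]
        refine SW.terminal (by rwa [dom_update]) ?_ (fun j v hv => ?_)
        · rintro rfl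
          have := hi' rfl
          simp only [lineBox, cond_true] at hleB
          omega
        · rw [update_apply] at hv
          split at hv
          · cases hv; exact hu
          · exact hF _ _ hv
  | @off k d idx i F u v F' B fl hi hv huv hlt h ih =>
    have hc := h.corner.1
    have hd := dom_update_of_mem u (mem_dom hv)
    rw [hd] at hc
    obtain ⟨hne', hv'⟩ := update_mem (m := place sp B ⟨M, e⟩) hc hv
    refine SW.off hi hv' huv (fun j w hj hw => hlt j w hj (update_line_ne hc hv hj hw)) ?_
    rw [update_comm hne'.symm]
    refine ih (fun b w hb => ?_) (hF _ _ hv) hn (by rwa [hd])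
    rw [update_apply] at hb
    split at hb
    · cases hb; exact hu
    · exact hF _ _ hb
  | @diag k idx F u v F' B fl hv huv h ih =>
    have hc := h.corner.1
    have hd := dom_update_of_mem (diagSwap sp u v).1 (mem_dom hv)
    rw [hd] at hc
    obtain ⟨hne', hv'⟩ := update_mem (m := place sp B ⟨M, e⟩) hc hv
    refine SW.diag hv' huv ?_
    rw [update_comm hne'.symm]
    refine ih (fun b w hb => ?_) ?_ hn (by rwa [hd])
    · rw [update_apply] at hb
      split at hb
      · cases hb; rw [(diagSwap_ceil _ _ _).1]; exact hu
      · exact hF _ _ hb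
    · rw [(diagSwap_ceil _ _ _).2]; exact hF _ _ hv

/-! ### Mixed insertion as a relation -/

theorem letter_lt_iff (a b : Letter) :
    a < b ↔ a.ceil < b.ceil ∨ a.ceil = b.ceil ∧ a.primed = true ∧ b.primed = false := by
  have h : a < b ↔ toLex (a.ceil, !a.primed) < toLex (b.ceil, !b.primed) := Iff.rfl
  rw [h, Prod.Lex.toLex_lt_toLex]
  cases a.primed <;> cases b.primed <;> simp

theorem letter_le_iff (a b : Letter) :
    a ≤ b ↔ a.ceil < b.ceil ∨ a.ceil = b.ceil ∧ (a.primed = true ∨ b.primed = false) := by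
  rw [← not_lt, letter_lt_iff]
  cases a.primed <;> cases b.primed <;> simp <;> omega

/-- The letter in cell `b`, with the prime on a diagonal entry (which records a sign) ignored. -/
def key (b : ℕ × ℕ) (x : Letter) : Letter := bif onDiag b then x.unprime else x

/-- The letter which a signed letter in cell `b` contributes to the extracted tableau. -/
def ext (sp : Bool) (b : ℕ × ℕ) (q : Bool × Letter) : Letter :=
  bif !sp && onDiag b then ⟨q.2.ceil, q.1⟩ else q.2

/-- `HM sp k idx Q e u Q' B e'`: mixed insertion of `(e, u)` into column (if `u` is primed) or row
`idx` of `Q` takes `k` stages, gives `Q'`, and adds the cell `B` with sign `e'`; the signs off the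
diagonal are not recorded in `Q`. -/
inductive HM (sp : Bool) :
    ℕ → ℕ → FTab Letter → Bool → Letter → FTab Letter → ℕ × ℕ → Bool → Prop
  | terminal {idx i : ℕ} {Q : FTab Letter} {e : Bool} {u : Letter}
      (hB : Corner (dom Q) (lineBox u.primed idx i)) (hd : u.primed = true → i ≠ idx)
      (hle : ∀ j v, Q (lineBox u.primed idx j) = some v → key (lineBox u.primed idx j) v ≤ u) :
      HM sp 1 idx Q e u
        (update Q (lineBox u.primed idx i) (some (ext sp (lineBox u.primed idx i) (e, u))))
        (lineBox u.primed idx i) e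
  | off {k : ℕ} {idx i : ℕ} {Q : FTab Letter} {e : Bool} {u v : Letter} {Q' : FTab Letter}
      {B : ℕ × ℕ} {e' : Bool} (hi : i ≠ idx) (hv : Q (lineBox u.primed idx i) = some v)
      (huv : u < v)
      (hle : ∀ j w, j < i → Q (lineBox u.primed idx j) = some w →
        key (lineBox u.primed idx j) w ≤ u)
      (h : HM sp k (bif v.primed then (lineBox u.primed idx i).2 + 1
          else (lineBox u.primed idx i).1 + 1)
        (update Q (lineBox u.primed idx i) (some u)) e v Q' B e') :
      HM sp (k + 1) idx Q e u Q' B e'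
  | diag {k : ℕ} {idx : ℕ} {Q : FTab Letter} {e : Bool} {u v : Letter} {Q' : FTab Letter}
      {B : ℕ × ℕ} {e' : Bool} (hu : u.primed = false) (hv : Q (idx, idx) = some v)
      (huv : u < v.unprime)
      (h : HM sp k (idx + 1) (update Q (idx, idx) (some (ext sp (idx, idx) (e, u))))
        (bif sp then e else v.primed) ⟨v.ceil, true⟩ Q' B e') :
      HM sp (k + 1) idx Q e u Q' B e'

theorem HM.corner {sp : Bool} {k idx : ℕ} {Q Q' : FTab Letter} {e : Bool} {u : Letter}
    {B : ℕ × ℕ} {e' : Bool} (h : HM sp k idx Q e u Q' B e') :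
    Corner (dom Q) B ∧ dom Q' = insert B (dom Q) := by
  induction h with
  | terminal hB hd hle => exact ⟨hB, dom_update _ _ _⟩
  | off hi hv huv hle h ih => rwa [dom_update_of_mem _ (mem_dom hv)] at ih
  | diag hu hv huv h ih => rwa [dom_update_of_mem _ (mem_dom hv)] at ih

theorem HM.add_other {sp : Bool} {k idx : ℕ} {Q Q' : FTab Letter} {e : Bool} {u : Letter}
    {B : ℕ × ℕ} {e' : Bool} (h : HM sp k idx Q e u Q' B e') {b : ℕ × ℕ} (m : Letter)
    (hb : Corner (dom Q) b) (hne : b ≠ B) :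
    HM sp k idx (update Q b (some m)) e u (update Q' b (some m)) B e' := by
  induction h with
  | terminal hB hd hle =>
    rw [update_comm hne.symm]
    refine HM.terminal ?_ hd fun j v hj => hle j v (update_line_end hb hB hne hj)
    rw [dom_update]
    exact hB.insert_other hb hne.symm
  | off hi hv huv hle h ih =>
    obtain ⟨hne', hv'⟩ := update_mem (m := m) hb hv
    refine HM.off hi hv' huv (fun j w hj hw => hle j w hj (update_line_ne hb hv hj hw)) ?_
    rw [update_comm hne'.symm]
    exact ih (by rwa [dom_update_of_mem _ (mem_dom hv)]) hne
  | diag hu hv huv h ih =>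
    obtain ⟨hne', hv'⟩ := update_mem (m := m) hb hv
    refine HM.diag hu hv' huv ?_
    rw [update_comm hne'.symm]
    exact ih (by rwa [dom_update_of_mem _ (mem_dom hv)]) hne

theorem NextTo.cell {d : Bool} {B B' : ℕ × ℕ} (h : NextTo d B B') :
    ∃ i', B' = ShiftedDuality.lineBox d (bif d then B.2 + 1 else B.1 + 1) i' ∧
      (d = true → i' ≤ B.1) := by
  obtain ⟨r, c⟩ := B'
  cases d
  · simp only [NextTo, cond_false] at h
    exact ⟨c, by simp [ShiftedDuality.lineBox, h.1], by simp⟩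
  · simp only [NextTo, cond_true] at h
    exact ⟨r, by simp [ShiftedDuality.lineBox, h.1], fun _ => h.2⟩

/-- If the cell added by a mixed insertion carries a letter `L` which is maximal in the sense of
the last two hypotheses, then `L` is bumped to the end of the next row or column. -/
theorem HM.add_hit {sp : Bool} {k idx : ℕ} {Q Q' : FTab Letter} {e : Bool} {u : Letter}
    {B : ℕ × ℕ} {e' : Bool} (h : HM sp k idx Q e u Q' B e') {l : ℤ} {fl : Bool} {B' : ℕ × ℕ}
    (hn : NextTo (fl || onDiag B) B B') (hB' : Corner (insert B (dom Q)) B')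
    (hlast : ∀ y, Q' B = some y → key B y < key B ⟨l, fl⟩)
    (hmax : ∀ b y, Q' b = some y → key b y ≤ ⟨l, fl || onDiag B⟩) :
    HM sp (k + 1) idx (update Q B (some ⟨l, fl⟩)) e u
      (update Q' B' (some (ext sp B' (bif !sp && onDiag B then fl else e', ⟨l, fl || onDiag B⟩))))
      B' (bif !sp && onDiag B then fl else e') := by
  induction h with
  | @terminal idx i Q e u hB hd hle =>
    have hleB := hB.le
    by_cases hi : i = idx
    · have hdf : u.primed = false := by
        cases hp : u.primed
        · rfl
        · exact absurd hi (hd hp)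
      rw [hdf] at hB hd hle hn hB' hlast hmax hleB ⊢
      subst hi
      have hon : onDiag (lineBox false i i) = true := by simp [lineBox, onDiag]
      simp only [hon, Bool.and_true, Bool.or_true] at hn hmax ⊢
      obtain ⟨i', rfl, hi'⟩ := hn.cell
      simp only [forall_const] at hi'
      have hi2 : i' ≤ i := hi'
      have hlast := hlast _ (by simp; rfl)
      have hk : key (lineBox false i i) (ext sp (lineBox false i i) (e, u)) = u := by
        obtain ⟨uc, up⟩ := u
        cases sp <;> simp_all [key, ext, Letter.unprime]
      rw [hk] at hlast
      refine HM.diag (v := ⟨l, fl⟩) hdf (by simp [lineBox])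
        (by simpa [key, hon] using hlast) ?_
      have e0 : ((i, i) : ℕ × ℕ) = lineBox false i i := rfl
      rw [e0, update_idem]
      have hst := HM.terminal (sp := sp) (idx := i + 1) (i := i')
        (Q := update Q (lineBox false i i) (some (ext sp (lineBox false i i) (e, u))))
        (e := bif sp then e else fl)
        (u := ⟨l, true⟩)
        (by rw [dom_update]; exact hB') (fun _ => by omega) (fun j v hv => hmax _ _ hv)
      have e1 : lineBox true ((lineBox false i i).2 + 1) i' = lineBox true (i + 1) i' := rfl
      cases sp <;> simpa [e1] using hst
    · have hon : onDiag (lineBox u.primed idx i) = false := by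
        simp [onDiag, lineBox_diag, hi]
      have hext : ∀ x, ext sp (lineBox u.primed idx i) x = x.2 := by simp [ext, hon]
      simp only [hext] at hlast hmax
      simp only [hon, Bool.and_false, Bool.or_false, cond_false, hext] at hn hmax ⊢
      have hlast := hlast u (by simp)
      simp only [key, hon, cond_false] at hlast
      obtain ⟨i', hB1, hi'⟩ := hn.cell
      refine HM.off (i := i) (v := ⟨l, fl⟩) hi (by simp) hlast
        (fun j w hj hw => hle j w ?_) ?_
      · rwa [update_of_ne] at hw
        exact fun h => by have := lineBox_inj h; omega
      · rw [update_idem, hB1]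
        refine HM.terminal (u := ⟨l, fl⟩) (by rw [dom_update]; rwa [hB1] at hB') ?_
          (fun j v hv => hmax _ _ hv)
        rintro h
        simp only at h
        subst h
        have := hi' rfl
        simp only [cond_true]
        omega
  | @off k idx i Q e u v Q' B e' hi hv huv hle h ih =>
    have hc := h.corner.1
    have hd := dom_update_of_mem u (mem_dom hv)
    rw [hd] at hc
    obtain ⟨hne', hv'⟩ := update_mem (m := ⟨l, fl⟩) hc hv
    refine HM.off hi hv' huv (fun j w hj hw => hle j w hj (update_line_ne hc hv hj hw)) ?_
    rw [update_comm hne'.symm]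
    exact ih hn (by rwa [hd]) hlast hmax
  | @diag k idx Q e u v Q' B e' hu hv huv h ih =>
    have hc := h.corner.1
    have hd := dom_update_of_mem (ext sp (idx, idx) (e, u)) (mem_dom hv)
    rw [hd] at hc
    obtain ⟨hne', hv'⟩ := update_mem (m := ⟨l, fl⟩) hc hv
    refine HM.diag hu hv' huv ?_
    rw [update_comm hne'.symm]
    exact ih hn (by rwa [hd]) hlast hmax

/-! ### Consecutive insertions with equal labels -/

/-- The relation between the cells `B, C` added at consecutive steps which both have the
same label; `p, q` tell whether these cells receive primed labels. -/
def Ascent (B : ℕ × ℕ) (p : Bool) (C : ℕ × ℕ) (q : Bool) : Prop :=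
  (p = false → q = false ∧ B.2 < C.2) ∧ (p = true → q = true → B.1 < C.1)

/-- The relation between the last added cell `B₀` and its counterpart `B₁` when a further cell `b`
is present throughout: either `b` is another corner, or `b` takes the place of `B₀` as the last
cell and `B₁ = b`. -/
def Link (S : Set (ℕ × ℕ)) (B₀ : ℕ × ℕ) (p₀ : Bool) (B₁ : ℕ × ℕ) (p₁ : Bool) (b : ℕ × ℕ) : Prop :=
  ∃ S₀, S = insert B₀ S₀ ∧ Corner S₀ B₀ ∧ (p₀ = true → onDiag B₀ = false) ∧
    (B₁ = B₀ ∧ p₁ = p₀ ∧ Corner S₀ b ∨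
      B₁ = b ∧ p₁ = (p₀ || onDiag B₀) ∧ NextTo (p₀ || onDiag B₀) B₀ b)

theorem Ascent.of_ne {S : Set (ℕ × ℕ)} {B₀ B₁ b B : ℕ × ℕ} {p₀ p₁ p : Bool}
    (h : Ascent B₀ p₀ B p) (hl : Link S B₀ p₀ B₁ p₁ b) (hp : p = true → onDiag B = false)
    (hB : Corner S B) : Ascent B₁ p₁ B p := by
  obtain ⟨S₀, rfl, hc, hp0, ⟨rfl, rfl, hb⟩ | ⟨rfl, rfl, hn⟩⟩ := hl
  · exact h
  · cases p₀ <;> cases hd : onDiag B₀ <;> cases p <;>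
      simp_all [Ascent, NextTo] <;> omega

theorem Ascent.of_eq {S : Set (ℕ × ℕ)} {B₀ B₁ b B' : ℕ × ℕ} {p₀ p₁ p : Bool}
    (h : Ascent B₀ p₀ b p) (hl : Link S B₀ p₀ B₁ p₁ b) (hp : p = true → onDiag b = false)
    (hS : IsShape S) (hb : Corner S b) (hn : NextTo (p || onDiag b) b B')
    (hB' : Corner (insert b S) B') :
    Ascent B₁ p₁ B' (p || onDiag b) := by
  obtain ⟨S₀, rfl, hc, hp0, ⟨rfl, rfl, hb0⟩ | ⟨rfl, rfl, hn0⟩⟩ := hl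
  · obtain ⟨e, x⟩ := B₁
    obtain ⟨r, y⟩ := b
    obtain ⟨r', y'⟩ := B'
    have hle := hc.le
    have hley := hb.le
    have hrow := hc.row
    have hcol0 := hb0.col
    have hrow0 := hb0.row
    have hnot := hB'.notMem
    have hne : ((e, x) : ℕ × ℕ) ≠ (r, y) := fun h => hb.notMem (h ▸ Set.mem_insert _ _)
    have hle' := hB'.le
    simp only at hle hley hrow hcol0 hrow0 hle'
    have key1 : e < r → y < x := fun her => ((hrow y).1 ((hcol0 e).2 her)).2
    have key2 : e = r → x < y → False := fun her hxy => by
      subst her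
      have := (hrow x).1 ((hrow0 x).2 ⟨hle, hxy⟩)
      omega
    have key3 : r' ≤ e → x < y' := fun h1 => by
      by_contra hcon
      refine hnot (Or.inr (hS.mono e x _ _ (Set.mem_insert _ _) h1 (by omega) hle'))
    have key4 : e = r → x = y → False := fun h1 h2 => hne (by rw [h1, h2])
    unfold Ascent at h ⊢
    cases p₁ <;> cases p <;> cases hd : onDiag (r, y) <;>
      simp_all [NextTo, onDiag] <;> omega
  · have hle := hb.le
    have hle0 := hc.le
    unfold Ascent at h ⊢
    cases hd0 : p₀ || onDiag B₀
    · simp only [Bool.or_eq_false_iff] at hd0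
      rw [hd0.1, hd0.2] at hn0
      simp only [NextTo, Bool.or_self, cond_false] at hn0
      have := (h.1 hd0.1).2
      omega
    · rw [hd0] at hn0
      simp only [NextTo, cond_true] at hn0
      have hd : onDiag B₁ = false := by
        simp only [onDiag, decide_eq_false_iff_not]
        omega
      refine ⟨by simp, fun _ h2 => ?_⟩
      rw [hd, Bool.or_false] at h2
      cases hp1 : p₀
      · rw [(h.1 hp1).1] at h2
        exact absurd h2 (by simp)
      · have := h.2 hp1 h2
        omega

/-! ### Inserting a word, and enlarging the word by a maximal letter -/

/-- `Run sp w P Q v B p`: Sagan–Worley insertion of the word `w` of labelled letters (last letter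
first) gives the tableaux `P` and `Q`; the last label is `v`, recorded in the cell `B`, and is
primed off the diagonal iff `p`. -/
inductive Run (sp : Bool) :
    List (ℤ × Letter) → FTab Letter → FTab Letter → ℤ → ℕ × ℕ → Bool → Prop
  | nil : Run sp [] (fun _ => none) (fun _ => none) 0 (0, 0) true
  | cons {w : List (ℤ × Letter)} {P Q : FTab Letter} {v : ℤ} {B₀ : ℕ × ℕ} {p₀ : Bool} {l : ℤ}
      {x : Letter} {k : ℕ} {P' : FTab Letter} {B : ℕ × ℕ} {fl : Bool}
      (h : Run sp w P Q v B₀ p₀) (hs : SW sp k false 0 P x P' B fl) (hk : k ≤ w.length + 1)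
      (hl : 0 < l) (hv : v ≤ l) (ha : v = l → Ascent B₀ p₀ B (fl && !onDiag B)) :
      Run sp ((l, x) :: w) P' (update Q B (some ⟨l, fl⟩)) l B (fl && !onDiag B)

section Run

variable {sp : Bool} {w : List (ℤ × Letter)} {P Q : FTab Letter} {v : ℤ} {B₀ : ℕ × ℕ} {p₀ : Bool}

theorem Run.dom_eq (h : Run sp w P Q v B₀ p₀) : dom P = dom Q := by
  induction h with
  | nil => rfl
  | cons h hs hk hl hv ha ih => rw [dom_update, ← ih, hs.corner.2]

theorem Run.isShape (h : Run sp w P Q v B₀ p₀) : IsShape (dom P) := by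
  induction h with
  | nil => simpa [dom] using isShape_empty
  | cons h hs hk hl hv ha ih => rw [hs.corner.2]; exact ih.insert hs.corner.1

theorem Run.forall_ceil (h : Run sp w P Q v B₀ p₀) (p : ℤ → Prop) (hw : ∀ q ∈ w, p q.2.ceil) :
    ∀ b x, P b = some x → p x.ceil := by
  induction h with
  | nil => simp
  | cons h hs hk hl hv ha ih =>
    simp only [List.forall_mem_cons] at hw
    exact hs.forall_ceil p (ih hw.2) hw.1

theorem Run.last_mem (h : Run sp w P Q v B₀ p₀) : 0 < v → B₀ ∈ dom P := by
  cases h with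
  | nil => simp
  | cons h hs hk hl hv ha => rw [hs.corner.2]; exact fun _ => Set.mem_insert _ _

theorem Run.last_eq (h : Run sp w P Q v B₀ p₀) : v = 0 ∨ ∃ q ∈ w, q.1 = v := by
  cases h with
  | nil => exact Or.inl rfl
  | cons h hs hk hl hv ha => exact Or.inr ⟨_, List.mem_cons_self, rfl⟩

theorem Run.key_le (h : Run sp w P Q v B₀ p₀) : ∀ b y, Q b = some y → key b y ≤ ⟨v, p₀⟩ ∧
    (key b y = ⟨v, p₀⟩ → (p₀ = true → b.1 ≤ B₀.1) ∧ (p₀ = false → b.2 ≤ B₀.2)) := by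
  induction h with
  | nil => simp
  | @cons w P Q v B₀ p₀ l x k P' B fl h hs hk hl hv ha ih =>
    intro b y hb
    rw [update_apply] at hb
    split at hb
    · rename_i hbB
      subst hbB
      cases hb
      have : key b ⟨l, fl⟩ = ⟨l, fl && !onDiag b⟩ := by
        unfold key; cases onDiag b <;> simp [Letter.unprime]
      rw [this]
      exact ⟨le_rfl, fun _ => ⟨fun _ => le_rfl, fun _ => le_rfl⟩⟩
    · obtain ⟨h1, h2⟩ := ih b y hb
      rcases hv.lt_or_eq with hv | rfl
      · have h3 : key b y < ⟨l, fl && !onDiag B⟩ := lt_of_le_of_lt h1 (by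
          rw [letter_lt_iff]; exact Or.inl hv)
        exact ⟨h3.le, fun h4 => absurd h4 h3.ne⟩
      · have ha := ha rfl
        generalize (fl && !onDiag B) = p at ha ⊢
        cases p₀
        · obtain ⟨rfl, h3⟩ := ha.1 rfl
          exact ⟨h1, fun h4 => ⟨by simp, fun _ => ((h2 h4).2 rfl).trans h3.le⟩⟩
        · cases p
          · have h3 : key b y < ⟨v, false⟩ := lt_of_le_of_lt h1 (by
              rw [letter_lt_iff]; exact Or.inr (by simp))
            exact ⟨h3.le, fun h4 => absurd h4 h3.ne⟩
          · exact ⟨h1, fun h4 => ⟨fun _ => ((h2 h4).1 rfl).trans (ha.2 rfl rfl).le, by simp⟩⟩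

end Run

/-- The hypotheses of `HM.add_hit` hold when the extra letter continues an ascent. -/
theorem Run.hit_bounds {sp : Bool} {w : List (ℤ × Letter)} {P Q : FTab Letter} {v l : ℤ}
    {B₁ B B' : ℕ × ℕ} {p₁ fl : Bool} (h : Run sp w P Q v B₁ p₁) (hv : v ≤ l)
    (ha : v = l → Ascent B₁ p₁ B' (fl || onDiag B)) (hn : NextTo (fl || onDiag B) B B') :
    (∀ y, Q B = some y → key B y < key B ⟨l, fl⟩) ∧
      ∀ b y, Q b = some y → key b y ≤ ⟨l, fl || onDiag B⟩ := by
  have hkey : key B ⟨l, fl⟩ = ⟨l, fl && !onDiag B⟩ := by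
    unfold key; cases onDiag B <;> simp [Letter.unprime]
  rw [hkey]
  rcases hv.lt_or_eq with hv | rfl
  · have hlt : ∀ p b y, Q b = some y → key b y < ⟨l, p⟩ := fun p b y hb =>
      lt_of_le_of_lt (h.key_le b y hb).1 (by rw [letter_lt_iff]; exact Or.inl hv)
    exact ⟨hlt _ _, fun b y hb => (hlt _ b y hb).le⟩
  · have ha := ha rfl
    cases p₁
    · obtain ⟨hd, h3⟩ := ha.1 rfl
      rw [hd] at hn ⊢
      simp only [Bool.or_eq_false_iff] at hd
      simp only [NextTo, cond_false] at hn
      rw [hd.1]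
      refine ⟨fun y hy => ?_, fun b y hb => (h.key_le b y hb).1⟩
      obtain ⟨h1, h2⟩ := h.key_le B y hy
      refine lt_of_le_of_ne h1 fun h4 => ?_
      have := (h2 h4).2 rfl
      omega
    · have hle : ∀ p, (⟨v, true⟩ : Letter) ≤ ⟨v, p⟩ := fun p => by
        rw [letter_le_iff]; exact Or.inr (by simp)
      refine ⟨fun y hy => ?_, fun b y hb => (h.key_le b y hb).1.trans (hle _)⟩
      obtain ⟨h1, h2⟩ := h.key_le B y hy
      refine lt_of_le_of_ne (h1.trans (hle _)) fun h4 => ?_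
      cases hp : fl && !onDiag B
      · rw [hp] at h4
        rw [h4, letter_le_iff] at h1
        simp at h1
      · rw [hp] at h4
        have hfl : (fl || onDiag B) = true := by
          simp only [Bool.and_eq_true] at hp
          simp [hp.1]
        rw [hfl] at ha hn
        have h5 := ha.2 rfl rfl
        have h6 := (h2 h4).1 rfl
        simp only [NextTo, cond_true] at hn
        omega

/-- Adding a maximal letter `m` with label `ℓ` to a word adds one entry to its insertion tableau,
and changes its recording tableau by the mixed insertion of `ℓ`. -/
theorem Run.add_letter {sp : Bool} {m : Letter} {ℓ : ℤ} (hℓ : 0 < ℓ) {X : List (ℤ × Letter)}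
    (hX : ∀ q ∈ X, q.1 ≤ ℓ) : ∀ {Y : List (ℤ × Letter)}, (∀ q ∈ Y, ℓ < q.1) →
    (∀ q ∈ Y ++ X, q.2.ceil < m.ceil) →
    ∀ {P Q : FTab Letter} {v : ℤ} {B₀ : ℕ × ℕ} {p₀ : Bool}, Run sp (Y ++ X) P Q v B₀ p₀ →
    ∃ Q₁ v₁ B₁ p₁ b e k,
      Run sp (Y ++ (ℓ, m) :: X) (update P b (some (place sp b ⟨m.ceil, e⟩))) Q₁ v₁ B₁ p₁ ∧
      Corner (dom P) b ∧ HM sp k 0 Q m.primed ⟨ℓ, false⟩ Q₁ b e ∧ k ≤ (Y ++ X).length + 1 ∧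
      (Y = [] ∧ v₁ = ℓ ∨ v₁ = v ∧ Link (dom P) B₀ p₀ B₁ p₁ b) := by
  intro Y
  induction Y with
  | nil =>
    intro _ hm P Q v B₀ p₀ h
    obtain ⟨c, hc⟩ := h.isShape.exists_corner_zero
    have hvl : v ≤ ℓ := by
      rcases h.last_eq with rfl | ⟨q, hq, rfl⟩
      · exact hℓ.le
      · exact hX q hq
    have hs := SW.terminal (sp := sp) (d := false) (idx := 0) (i := c) (F := P) (u := m) hc
      (by simp) fun j x hx => h.forall_ceil (· < m.ceil) hm _ _ hx
    have hH := HM.terminal (sp := sp) (idx := 0) (i := c) (Q := Q) (e := m.primed) (u := ⟨ℓ, false⟩)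
      (by rw [← h.dom_eq]; exact hc) (by simp) fun j x hx => by
        refine (h.key_le _ _ hx).1.trans ?_
        rw [letter_le_iff]
        rcases hvl.lt_or_eq with hv | hv
        · exact Or.inl hv
        · exact Or.inr (by simp [hv])
    have hR := Run.cons h hs (Nat.le_add_left _ _) hℓ hvl (fun hv => ?_)
    · refine ⟨_, _, _, _, _, _, _, hR, hc, ?_, Nat.le_add_left _ _, Or.inl ⟨rfl, rfl⟩⟩
      convert hH using 3
      change _ = ext sp (lineBox false 0 c) _
      unfold ext
      cases sp <;> cases onDiag (lineBox false 0 c) <;> simp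
    · have hp : ((false || (!sp && onDiag (lineBox false 0 c) && m.primed)) &&
          !onDiag (lineBox false 0 c)) = false := by
        cases onDiag (lineBox false 0 c) <;> simp
      rw [hp]
      refine ⟨fun _ => ⟨rfl, ?_⟩, by simp⟩
      have hmem := h.last_mem (by omega)
      exact ((hc.row B₀.2).1 (h.isShape.mono _ _ _ _ hmem (Nat.zero_le _) le_rfl
        (Nat.zero_le _))).2
  | cons y Y ih =>
    intro hY hm P' Q' l B p' h
    simp only [List.forall_mem_cons] at hY
    simp only [List.cons_append, List.forall_mem_cons] at hm
    simp only [List.cons_append] at h ⊢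
    cases h with
    | @cons _ P Q v B₀ p₀ _ x k _ _ fl h hs hk hl hv ha =>
    obtain ⟨Q₁, v₁, B₁, p₁, b, e, k', hR, hb, hH, hk', hlast⟩ := ih hY.2 hm.2 h
    have hlY := hY.1
    simp only at hlY
    have hlen : (Y ++ (ℓ, m) :: X).length = (Y ++ X).length + 1 := by
      simp only [List.length_append, List.length_cons]; omega
    have hv₁ : v₁ ≤ l := by
      rcases hlast with ⟨_, rfl⟩ | ⟨rfl, _⟩
      · exact hlY.le
      · exact hv
    have hL : v₁ = l → Ascent B₀ p₀ B (fl && !onDiag B) ∧ Link (dom P) B₀ p₀ B₁ p₁ b := by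
      rintro rfl
      rcases hlast with ⟨_, rfl⟩ | ⟨rfl, h1⟩
      · exact absurd hlY (lt_irrefl _)
      · exact ⟨ha rfl, h1⟩
    obtain ⟨hB, hdom⟩ := hs.corner
    have hpd : (fl && !onDiag B) = true → onDiag B = false := by
      cases onDiag B <;> simp
    by_cases hne : b = B
    · subst hne
      have hpo : ((fl && !onDiag b) || onDiag b) = (fl || onDiag b) := by
        cases onDiag b <;> simp
      obtain ⟨B', hn, hB'⟩ := h.isShape.exists_next hb (fl || onDiag b) (by simp [onDiag])
      have hd' : (fl || onDiag b) = true → onDiag B' = false := fun hd => by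
        rw [hd] at hn
        have := hb.le
        simp only [NextTo, cond_true] at hn
        simp only [onDiag, decide_eq_false_iff_not]
        omega
      have hA : v₁ = l → Ascent B₁ p₁ B' (fl || onDiag b) := fun hvl => by
        obtain ⟨h1, h2⟩ := hL hvl
        have := h1.of_eq h2 hpd h.isShape hb (by rwa [hpo]) hB'
        rwa [hpo] at this
      obtain ⟨hlast', hmax⟩ := hR.hit_bounds hv₁ hA hn
      have hS := hs.add_hit (M := m.ceil) (e := e) (h.forall_ceil (· < m.ceil) hm.2) hm.1 hn hB'
      have hH' := hH.add_hit hn (by rwa [← h.dom_eq]) hlast' hmax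
      have hR' := Run.cons (l := l) hR hS (by omega) hl hv₁ (fun hvl => by
        convert hA hvl using 1
        revert hd'
        cases fl || onDiag b <;> cases onDiag B' <;> simp)
      refine ⟨_, _, _, _, _, _, k' + 1, hR', ?_, ?_, ?_, Or.inr ⟨rfl, dom P, hdom, hb, hpd,
        Or.inr ⟨rfl, ?_, by rwa [hpo]⟩⟩⟩
      · rwa [hdom]
      · convert hH' using 3
        unfold ext
        revert hd'
        cases sp <;> cases fl || onDiag b <;> cases onDiag B' <;> simp
      · simp only [List.length_cons]; omega
      · rw [hpo]
        revert hd'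
        cases fl || onDiag b <;> cases onDiag B' <;> simp
    · have hS := hs.add_other (place sp b ⟨m.ceil, e⟩) hb hne
      have hH' := hH.add_other (b := B) ⟨l, fl⟩ (by rwa [← h.dom_eq]) (Ne.symm hne)
      have hR' := Run.cons (l := l) hR hS (by omega) hl hv₁ (fun hvl =>
        (hL hvl).1.of_ne (hL hvl).2 hpd hB)
      refine ⟨_, _, _, _, _, _, _, hR', ?_, hH', ?_, Or.inr ⟨rfl, dom P, hdom, hB, hpd,
        Or.inl ⟨rfl, rfl, hb⟩⟩⟩
      · rw [hdom]; exact hb.insert_other hB hne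
      · simp only [List.length_cons]; omega

/-! ### Tableaux as lists of rows -/

section Rows

variable {α : Type} {T T' : List (List α)} {r c : ℕ}

/-- The partial function on cells described by a list of rows. -/
def toF (T : List (List α)) : FTab α := fun b => entryG? T b.1 b.2

/-- No row is empty. -/
def Full (T : List (List α)) : Prop := ∀ row ∈ T, row ≠ []

/-- Add `x` at the end of row `r`. -/
def addEntry (T : List (List α)) (r : ℕ) (x : α) : List (List α) :=
  setRowG T r (T.getD r [] ++ [x])

theorem toF_apply (T : List (List α)) (r c : ℕ) :
    toF T (r, c) = if r ≤ c then (T.getD r [])[c - r]? else none := by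
  unfold toF entryG?
  simp only
  split
  · rw [List.getD_eq_getElem?_getD]
    cases T[r]? <;> simp
  · rfl

theorem toF_eq_some {x : α} :
    toF T (r, c) = some x ↔ r ≤ c ∧ (T.getD r [])[c - r]? = some x := by
  rw [toF_apply]; split <;> simp_all

theorem mem_dom_toF : (r, c) ∈ dom (toF T) ↔ r ≤ c ∧ c < r + (T.getD r []).length := by
  simp only [dom, Set.mem_ofPred_eq, toF_apply]
  split
  · simp only [ne_eq, List.getElem?_eq_none_iff, not_le]; omega
  · simp only [ne_eq, not_true_eq_false, false_iff]; omega

theorem lt_length_of_mem (h : (r, c) ∈ dom (toF T)) : r < T.length := by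
  by_contra hr
  rw [mem_dom_toF, List.getD_eq_default _ _ (by omega)] at h
  simp only [List.length_nil] at h
  omega

theorem Full.lt_length_iff (h : Full T) : r < T.length ↔ T.getD r [] ≠ [] := by
  refine ⟨fun hr => ?_, fun hr => ?_⟩
  · rw [List.getD_eq_getElem _ _ hr]
    exact h _ (List.getElem_mem hr)
  · by_contra hcon
    exact hr (List.getD_eq_default _ _ (by omega))

theorem Full.eq_of_toF (h : Full T) (h' : Full T') (e : toF T = toF T') : T = T' := by
  have hrow : ∀ r, T.getD r [] = T'.getD r [] := fun r => by
    refine List.ext_getElem? fun k => ?_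
    have := congrFun e (r, r + k)
    rw [toF_apply, toF_apply] at this
    simpa using this
  refine List.ext_getElem ?_ fun r h1 h2 => ?_
  · by_contra hne
    rcases lt_or_gt_of_ne hne with hlt | hlt
    · have h1 := h'.lt_length_iff.1 hlt
      rw [← hrow] at h1
      exact lt_irrefl _ (h.lt_length_iff.2 h1)
    · have h1 := h.lt_length_iff.1 hlt
      rw [hrow] at h1
      exact lt_irrefl _ (h'.lt_length_iff.2 h1)
  · have := hrow r
    rwa [List.getD_eq_getElem _ _ h1, List.getD_eq_getElem _ _ h2] at this

theorem getD_setRowG (h : r ≤ T.length) (row : List α) (s : ℕ) :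
    (setRowG T r row).getD s [] = if s = r then row else T.getD s [] := by
  unfold setRowG
  simp only [List.getD_eq_getElem?_getD]
  split
  next h1 =>
    rw [List.getElem?_set]
    by_cases hs : s = r
    · subst hs; simp [h1]
    · rw [if_neg (Ne.symm hs), if_neg hs]
  · have hr : r = T.length := by omega
    subst hr
    rw [List.getElem?_append]
    split
    · rw [if_neg (by omega)]
    · split
      · simp_all
      · rw [List.getElem?_eq_none (by simp only [List.length_singleton]; omega),
          List.getElem?_eq_none (by omega)]

theorem Full.setRowG (h : Full T) {row : List α} (hrow : row ≠ []) : Full (setRowG T r row) := by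
  unfold _root_.setRowG
  intro row' h'
  split at h'
  · rcases List.mem_or_eq_of_mem_set h' with h1 | rfl
    · exact h _ h1
    · exact hrow
  · rcases List.mem_append.1 h' with h1 | h1
    · exact h _ h1
    · rw [List.mem_singleton.1 h1]; exact hrow

theorem length_flatten_setRowG (row : List α) :
    (setRowG T r row).flatten.length + (T.getD r []).length = T.flatten.length + row.length := by
  unfold setRowG
  split
  · rename_i hr
    induction T generalizing r with
    | nil => simp at hr
    | cons a T ih =>
      cases r with
      | zero => simp only [List.set_cons_zero, List.flatten_cons, List.length_append,
          List.getD_cons_zero]; omega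
      | succ r =>
        have := ih (r := r) (by simpa using hr)
        simp only [List.set_cons_succ, List.flatten_cons, List.length_append,
          List.getD_cons_succ] at this ⊢
        omega
  · rw [List.getD_eq_default _ _ (by omega)]
    simp

theorem setEntryG_eq (h : (r, c) ∈ dom (toF T)) (x : α) :
    setEntryG T r c x = setRowG T r ((T.getD r []).set (c - r) x) := by
  unfold setEntryG setRowG
  rw [if_pos (lt_length_of_mem h)]

theorem toF_setEntryG (h : (r, c) ∈ dom (toF T)) (x : α) :
    toF (setEntryG T r c x) = update (toF T) (r, c) (some x) := by
  have hr := lt_length_of_mem h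
  rw [setEntryG_eq h]
  ext1 b
  obtain ⟨s, y⟩ := b
  rw [toF_apply, getD_setRowG hr.le, update_apply, toF_apply]
  obtain ⟨h1, h2⟩ := mem_dom_toF.1 h
  simp only [Prod.mk.injEq]
  split
  · split
    · rename_i hs
      subst hs
      rw [List.getElem?_set]
      simp only [true_and]
      split
      · rw [if_pos (by omega), if_pos (by omega)]
      · rw [if_neg (by omega)]
    · rename_i hs
      simp [hs]
  · rw [if_neg (by omega)]

theorem length_flatten_setEntryG (h : (r, c) ∈ dom (toF T)) (x : α) :
    (setEntryG T r c x).flatten.length = T.flatten.length := by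
  have := length_flatten_setRowG (T := T) (r := r) ((T.getD r []).set (c - r) x)
  rw [setEntryG_eq h]
  rw [List.length_set] at this
  omega

theorem Full.setEntryG (hT : Full T) (h : (r, c) ∈ dom (toF T)) (x : α) :
    Full (setEntryG T r c x) := by
  rw [setEntryG_eq h]
  refine hT.setRowG fun h1 => ?_
  have h2 := congrArg List.length h1
  have := (mem_dom_toF.1 h)
  simp only [List.length_set, List.length_nil] at h2
  omega

theorem Corner.length_row (h : Corner (dom (toF T)) (r, c)) : (T.getD r []).length = c - r := by
  have h1 := h.row c
  have h2 := h.row (r + (T.getD r []).length)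
  have h3 := h.le
  have h4 := h.row (c - 1)
  simp only [mem_dom_toF] at h1 h2 h3 h4
  omega

theorem Corner.le_length (h : Corner (dom (toF T)) (r, c)) : r ≤ T.length := by
  cases r with
  | zero => exact Nat.zero_le _
  | succ r => exact lt_length_of_mem ((h.col r).2 (Nat.lt_succ_self r))

theorem toF_addEntry (h : Corner (dom (toF T)) (r, c)) (x : α) :
    toF (addEntry T r x) = update (toF T) (r, c) (some x) := by
  have hl := h.length_row
  have hle := h.le
  ext1 b
  obtain ⟨s, y⟩ := b
  rw [addEntry, toF_apply, getD_setRowG h.le_length, update_apply, toF_apply]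
  simp only [Prod.mk.injEq] at hle ⊢
  split
  · split
    · rename_i hs
      subst hs
      simp only [true_and]
      rw [List.getElem?_append, hl]
      split
      · rw [if_neg (by omega)]
      · split
        · have : y - s - (c - s) = 0 := by omega
          rw [this]; simp
        · rw [List.getElem?_eq_none (by simp only [List.length_singleton]; omega),
            List.getElem?_eq_none (by omega)]
    · rename_i hs
      simp [hs]
  · rw [if_neg (by omega)]

theorem length_flatten_addEntry (x : α) :
    (addEntry T r x).flatten.length = T.flatten.length + 1 := by
  have := length_flatten_setRowG (T := T) (r := r) (T.getD r [] ++ [x])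
  rw [List.length_append, List.length_singleton] at this
  unfold addEntry
  omega

theorem Full.addEntry (hT : Full T) (x : α) : Full (addEntry T r x) :=
  hT.setRowG (by simp)

theorem findIdx?_row_eq_none {p : α → Bool}
    (h : ∀ j v, toF T (r, j) = some v → p v = false) : (T.getD r []).findIdx? p = none := by
  rw [List.findIdx?_eq_none_iff]
  intro x hx
  obtain ⟨k, hk⟩ := List.mem_iff_getElem?.1 hx
  exact h (r + k) x (toF_eq_some.2 ⟨by omega, by simpa using hk⟩)

theorem findIdx?_row_eq_some {p : α → Bool} {v : α} (hv : toF T (r, c) = some v) (hp : p v = true)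
    (h : ∀ j w, j < c → toF T (r, j) = some w → p w = false) :
    (T.getD r []).findIdx? p = some (c - r) := by
  obtain ⟨h1, h2⟩ := toF_eq_some.1 hv
  rw [List.findIdx?_eq_some_iff_getElem]
  obtain ⟨h3, h4⟩ := List.getElem?_eq_some_iff.1 h2
  refine ⟨h3, by rwa [h4], fun j hj => ?_⟩
  have := h (r + j) ((T.getD r [])[j]'(by omega)) (by omega)
    (toF_eq_some.2 ⟨by omega, by simp⟩)
  rw [this]; simp

theorem getD_row [Inhabited α] {v : α} (hv : toF T (r, c) = some v) :
    (T.getD r []).getD (c - r) default = v := by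
  obtain ⟨h1, h2⟩ := toF_eq_some.1 hv
  rw [List.getD_eq_getElem?_getD, h2]; rfl

theorem find?_col_eq_none {p : ℕ × α → Bool}
    (h : ∀ j v, toF T (j, c) = some v → p (j, v) = false) :
    ((List.range (c + 1)).filterMap
      fun r => (entryG? T r c).map fun x => (r, x)).find? p = none := by
  rw [List.find?_eq_none]
  intro x hx
  rw [List.mem_filterMap] at hx
  obtain ⟨j, -, hj⟩ := hx
  rw [Option.map_eq_some_iff] at hj
  obtain ⟨v, hv, rfl⟩ := hj
  rw [h j v hv]; simp

theorem find?_col_eq_some {p : ℕ × α → Bool} {v : α} (hv : toF T (r, c) = some v)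
    (hp : p (r, v) = true) (h : ∀ j w, j < r → toF T (j, c) = some w → p (j, w) = false) :
    ((List.range (c + 1)).filterMap
      fun r => (entryG? T r c).map fun x => (r, x)).find? p = some (r, v) := by
  have hr : r ≤ c := (toF_eq_some.1 hv).1
  have hv' : entryG? T r c = some v := hv
  rw [List.find?_filterMap]
  have : (List.range (c + 1)).find?
      (fun r => ((entryG? T r c).map fun x => (r, x)).any p) = some r := by
    rw [List.find?_range_eq_some]
    refine ⟨by simpa [hv'] using hp, by simp; omega, fun j hj => ?_⟩
    cases hw : entryG? T j c with
    | none => simp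
    | some w => simpa using h j w hj hw
  rw [this]
  simp [hv']

theorem length_col (h : Corner (dom (toF T)) (r, c)) :
    ((List.range (c + 1)).filterMap
      fun r => (entryG? T r c).map fun x => (r, x)).length = r := by
  have key : ∀ n, ((List.range n).filterMap
      fun r => (entryG? T r c).map fun x => (r, x)).length = min n r := by
    intro n
    induction n with
    | zero => simp
    | succ n ih =>
      rw [List.range_succ, List.filterMap_append, List.length_append, ih]
      have hn := h.col n
      simp only at hn
      cases he : entryG? T n c with
      | none =>
        have : (n, c) ∉ dom (toF T) := by simp [dom, toF, he]
        have := mt hn.2 this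
        simp only [List.filterMap_cons, he, Option.map_none, List.filterMap_nil, List.length_nil]
        omega
      | some w =>
        have : (n, c) ∈ dom (toF T) := mem_dom (x := w) he
        have := hn.1 this
        simp only [List.filterMap_cons, he, Option.map_some, List.filterMap_nil, List.length_cons,
          List.length_nil]
        omega
  have := h.le
  simp only at this
  rw [key]
  omega

end Rows

/-! ### Sagan–Worley insertion of lists of rows -/

theorem swBump_of_lt {b : Bool} {u v : Letter} (h : u.ceil < v.ceil) : swBump b u v = true := by
  have h1 : u < v := (letter_lt_iff _ _).2 (Or.inl h)
  unfold swBump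
  split <;> simp [h1, h1.le]

theorem swBump_of_gt {b : Bool} {u v : Letter} (h : v.ceil < u.ceil) : swBump b u v = false := by
  have h1 : v < u := (letter_lt_iff _ _).2 (Or.inl h)
  unfold swBump
  split <;> simp [h1, h1.le]

/-- Insertion into column (`d = true`) or row `idx`, orthogonal or symplectic. -/
def swIns (sp d : Bool) (fuel : ℕ) (T : STab) (idx : ℕ) (u : Letter) : STab × Bool :=
  bif d then (bif sp then swColSp fuel T idx u else swColO fuel T idx u)
  else (bif sp then swRowSp fuel T idx u else swRowO fuel T idx u)

section

variable {sp d : Bool} {fuel idx i : ℕ} {T : STab} {u v : Letter}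

theorem swIns_terminal (hB : Corner (dom (toF T)) (lineBox d idx i)) (hd : d = true → i ≠ idx)
    (hlt : ∀ j v, toF T (lineBox d idx j) = some v → v.ceil < u.ceil) :
    swIns sp d (fuel + 1) T idx u =
      (addEntry T (lineBox d idx i).1 (place sp (lineBox d idx i) u),
        d || (!sp && onDiag (lineBox d idx i) && u.primed)) := by
  cases d
  · have h1 := findIdx?_row_eq_none (T := T) (r := idx) (p := fun v => swBump true u v)
      fun j v hv => swBump_of_gt (hlt j v hv)
    have h2 := hB.length_row
    have h3 := hB.le
    simp only [lineBox, cond_false] at h2 h3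
    cases sp
    · simp only [swIns, cond_false, swRowO, h1]
      by_cases hi : i = idx
      · subst hi
        have h4 : T.getD i [] = [] := List.length_eq_zero_iff.1 (by omega)
        simp only [h4, List.isEmpty_nil, true_and, lineBox, cond_false, place, onDiag, addEntry]
        cases hu : u.primed <;> simp [Letter.unprime]
        cases u
        simp only at hu
        rw [hu]
      · have h4 : (T.getD idx []).isEmpty = false := by
          cases h : T.getD idx [] with
          | nil => rw [h] at h2; simp only [List.length_nil] at h2; omega
          | cons => rfl
        have h5 : onDiag (idx, i) = false := by simpa [onDiag] using Ne.symm hi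
        simp only [h4, Bool.false_eq_true, false_and, if_false]
        simp [lineBox, place, h5, addEntry]
    · simp only [swIns, cond_false, cond_true, swRowSp, h1]
      simp [lineBox, place, addEntry]
  · have h1 := find?_col_eq_none (T := T) (c := idx) (p := fun p => swBump false u p.2)
      fun j v hv => swBump_of_gt (hlt j v hv)
    have h2 := length_col hB
    have h3 := hd rfl
    have h5 : onDiag (i, idx) = false := by simpa [onDiag] using h3
    cases sp
    · simp only [swIns, cond_false, cond_true, swColO, entry?, h1, h2]
      simp [lineBox, place, h5, h3, addEntry]
    · simp only [swIns, cond_true, swColSp, entry?, h1, h2]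
      simp [lineBox, place, addEntry]

theorem swIns_off (hi : i ≠ idx) (hv : toF T (lineBox d idx i) = some v)
    (huv : u.ceil < v.ceil)
    (hlt : ∀ j w, j < i → toF T (lineBox d idx j) = some w → w.ceil < u.ceil) :
    swIns sp d (fuel + 1) T idx u =
      swIns sp d fuel (setEntryG T (lineBox d idx i).1 (lineBox d idx i).2 u) (idx + 1) v := by
  cases d
  · have hv' : toF T (idx, i) = some v := hv
    have h1 := findIdx?_row_eq_some (p := fun v => swBump true u v) hv' (swBump_of_lt huv)
      fun j w hj hw => swBump_of_gt (hlt j w hj hw)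
    have h2 := getD_row hv'
    have h3 : i - idx ≠ 0 := by
      have := (toF_eq_some.1 hv').1
      omega
    have h4 := setEntryG_eq (mem_dom hv') u
    cases sp <;> simp only [swIns, cond_false, cond_true, swRowO, swRowSp, h1, h2, h3, if_false,
      lineBox, h4]
  · have hv' : toF T (i, idx) = some v := hv
    have h1 := find?_col_eq_some (p := fun p => swBump false u p.2) hv' (swBump_of_lt huv)
      fun j w hj hw => swBump_of_gt (hlt j w hj hw)
    cases sp <;> simp only [swIns, cond_false, cond_true, swColO, swColSp, entry?, h1, hi, if_false,
      lineBox]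

theorem swIns_diag (hv : toF T (idx, idx) = some v) (huv : u.ceil < v.ceil) :
    swIns sp false (fuel + 1) T idx u =
      swIns sp true fuel (setEntryG T idx idx (diagSwap sp u v).1) (idx + 1)
        (diagSwap sp u v).2 := by
  have h1 := findIdx?_row_eq_some (p := fun v => swBump true u v) hv (swBump_of_lt huv)
    fun j w hj hw => by
      have := (toF_eq_some.1 hw).1
      omega
  have h2 := getD_row hv
  have h4 := setEntryG_eq (mem_dom hv) (diagSwap sp u v).1
  rw [Nat.sub_self] at h1 h2 h4
  cases sp <;> simp only [swIns, cond_false, cond_true, swRowO, swRowSp, h1, h2, if_true, huv.ne,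
    if_false, h4] <;> rfl

end

/-- The relation `SW` describes the insertion of lists of rows. -/
theorem SW.exec {sp : Bool} {k : ℕ} {d : Bool} {idx : ℕ} {F F' : FTab Letter} {u : Letter}
    {B : ℕ × ℕ} {fl : Bool} (h : SW sp k d idx F u F' B fl) :
    ∀ {T : STab} {fuel : ℕ}, Full T → toF T = F → k ≤ fuel →
      ∃ T', swIns sp d fuel T idx u = (T', fl) ∧ Full T' ∧ toF T' = F' ∧
        T'.flatten.length = T.flatten.length + 1 := by
  induction h with
  | terminal hB hd hlt =>
    rintro T fuel hT rfl hk
    obtain ⟨fuel, rfl⟩ := Nat.exists_eq_add_of_le' hk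
    exact ⟨_, swIns_terminal hB hd hlt, hT.addEntry _, toF_addEntry hB _, length_flatten_addEntry _⟩
  | off hi hv huv hlt h ih =>
    rintro T fuel hT rfl hk
    obtain ⟨fuel, rfl⟩ := Nat.exists_eq_add_of_le' (le_of_add_le_right hk)
    have hm := mem_dom hv
    rw [swIns_off hi hv huv hlt]
    have := ih (T := setEntryG T _ _ _) (hT.setEntryG hm _) (toF_setEntryG hm _)
      (Nat.le_of_succ_le_succ hk)
    rwa [length_flatten_setEntryG hm] at this
  | diag hv huv h ih =>
    rintro T fuel hT rfl hk
    obtain ⟨fuel, rfl⟩ := Nat.exists_eq_add_of_le' (le_of_add_le_right hk)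
    have hm := mem_dom hv
    rw [swIns_diag hv huv]
    have := ih (hT.setEntryG hm _) (toF_setEntryG hm _) (Nat.le_of_succ_le_succ hk)
    rwa [length_flatten_setEntryG hm] at this

/-! ### Mixed insertion of lists of rows -/

/-- The signed tableau `U` has the entries `Q`, with unprimed letters on the diagonal. -/
structure MRep (sp : Bool) (U : MTab) (Q : FTab Letter) : Prop where
  full : Full U
  map : ∀ b, Q b = (toF U b).map (ext sp b)
  diag : ∀ b y, toF U b = some y → onDiag b = true → y.2.primed = false

section

variable {sp : Bool} {U : MTab} {Q : FTab Letter}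

theorem key_ext {b : ℕ × ℕ} {q : Bool × Letter} (h : onDiag b = true → q.2.primed = false) :
    key b (ext sp b q) = q.2 := by
  obtain ⟨e, c, p⟩ := q
  cases sp <;> cases hb : onDiag b <;> simp_all [key, ext, Letter.unprime]

theorem MRep.dom_eq (h : MRep sp U Q) : dom (toF U) = dom Q := by
  ext b
  simp [dom, h.map]

theorem MRep.key_eq (h : MRep sp U Q) {b : ℕ × ℕ} {y : Bool × Letter} (hy : toF U b = some y) :
    Q b = some (ext sp b y) ∧ key b (ext sp b y) = y.2 :=
  ⟨by rw [h.map, hy]; rfl, key_ext (h.diag b y hy)⟩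

theorem MRep.exists_of_eq (h : MRep sp U Q) {b : ℕ × ℕ} {v : Letter} (hv : Q b = some v) :
    ∃ y, toF U b = some y ∧ ext sp b y = v := by
  rw [h.map, Option.map_eq_some_iff] at hv
  exact hv

theorem MRep.update {U' : MTab} {b : ℕ × ℕ} {y : Bool × Letter} (h : MRep sp U Q)
    (hU' : Full U') (e : toF U' = update (toF U) b (some y))
    (hy : onDiag b = true → y.2.primed = false) :
    MRep sp U' (update Q b (some (ext sp b y))) := by
  refine ⟨hU', fun a => ?_, fun a z hz ha => ?_⟩
  · rw [e]
    by_cases hab : a = b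
    · subst hab; simp
    · simp [hab, h.map]
  · rw [e] at hz
    by_cases hab : a = b
    · subst hab
      simp only [update_self, Option.some.injEq] at hz
      subst hz
      exact hy ha
    · rw [update_of_ne hab] at hz
      exact h.diag a z hz ha

theorem ext_of_not_diag {b : ℕ × ℕ} (hb : onDiag b = false) (q : Bool × Letter) :
    ext sp b q = q.2 := by
  simp [ext, hb]

variable {fuel idx i : ℕ} {e : Bool} {u : Letter}

theorem hmIns_terminal (hB : Corner (dom (toF U)) (lineBox u.primed idx i))
    (hle : ∀ j y, toF U (lineBox u.primed idx j) = some y → y.2 ≤ u) :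
    hmIns sp (fuel + 1) U u.primed idx (e, u) =
      (addEntry U (lineBox u.primed idx i).1 (e, u), lineBox u.primed idx i) := by
  cases hu : u.primed <;> rw [hu] at hB hle
  · have h1 := findIdx?_row_eq_none (T := U) (r := idx) (p := fun p => decide (u < p.2))
      fun j v hv => by simpa using hle j v hv
    have h2 := hB.length_row
    have h3 := hB.le
    simp only [lineBox, cond_false] at h2 h3
    simp only [hmIns, h1, lineBox, cond_false, addEntry, h2, Bool.false_eq_true, if_false,
      Nat.add_sub_cancel' h3]
  · have h1 := find?_col_eq_none (T := U) (c := idx) (p := fun p => decide (u < p.2.2))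
      fun j v hv => by simpa using hle j v hv
    have h2 := length_col hB
    simp only [hmIns, h1, h2, if_true]
    rfl

theorem hmIns_off {y : Bool × Letter} (hi : i ≠ idx)
    (hy : toF U (lineBox u.primed idx i) = some y) (huy : u < y.2)
    (hle : ∀ j w, j < i → toF U (lineBox u.primed idx j) = some w → w.2 ≤ u) :
    hmIns sp (fuel + 1) U u.primed idx (e, u) =
      hmIns sp fuel (setEntryG U (lineBox u.primed idx i).1 (lineBox u.primed idx i).2 (y.1, u))
        y.2.primed (bif y.2.primed then (lineBox u.primed idx i).2 + 1
          else (lineBox u.primed idx i).1 + 1) (e, y.2) := by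
  cases hu : u.primed <;> rw [hu] at hy hle
  · have hy' : toF U (idx, i) = some y := hy
    have h1 := findIdx?_row_eq_some (p := fun p => decide (u < p.2)) hy' (by simpa using huy)
      fun j w hj hw => by simpa using hle j w hj hw
    have h2 := getD_row hy'
    have h0 := (toF_eq_some.1 hy').1
    have h3 : i - idx ≠ 0 := by omega
    have h4 := setEntryG_eq (mem_dom hy') (y.1, u)
    simp only [hmIns, h1, h2, h3, lineBox, cond_false, Bool.false_eq_true, if_false, h4,
      Nat.add_sub_cancel' h0]
    cases y.2.primed <;> rfl
  · have hy' : toF U (i, idx) = some y := hy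
    have h1 := find?_col_eq_some (p := fun p => decide (u < p.2.2)) hy' (by simpa using huy)
      fun j w hj hw => by simpa using hle j w hj hw
    simp only [hmIns, h1, hi, lineBox, cond_true, if_true, if_false]
    cases y.2.primed <;> rfl

theorem hmIns_diag {y : Bool × Letter} (hy : toF U (idx, idx) = some y) (huy : u < y.2) :
    hmIns sp (fuel + 1) U false idx (e, u) =
      hmIns sp fuel (setEntryG U idx idx (bif sp then (y.1, u) else (e, u))) true (idx + 1)
        (bif sp then (e, ⟨y.2.ceil, true⟩) else (y.1, ⟨y.2.ceil, true⟩)) := by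
  have h1 := findIdx?_row_eq_some (p := fun p => decide (u < p.2)) hy (by simpa using huy)
    fun j w hj hw => by
      have := (toF_eq_some.1 hw).1
      omega
  have h2 := getD_row hy
  have h4 := setEntryG_eq (mem_dom hy) (bif sp then (y.1, u) else (e, u))
  rw [Nat.sub_self] at h1 h2 h4
  simp only [hmIns, h1, h2, Bool.false_eq_true, if_false, if_true, h4]
  cases sp <;> rfl

end

/-- The relation `HM` describes the mixed insertion of lists of rows. -/
theorem HM.exec {sp : Bool} {k idx : ℕ} {Q Q' : FTab Letter} {e : Bool} {u : Letter}
    {B : ℕ × ℕ} {e' : Bool} (h : HM sp k idx Q e u Q' B e') :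
    ∀ {U : MTab} {fuel : ℕ}, MRep sp U Q → k ≤ fuel →
      ∃ U', hmIns sp fuel U u.primed idx (e, u) = (U', B) ∧ MRep sp U' Q' ∧
        U'.flatten.length = U.flatten.length + 1 ∧ (toF U' B).map Prod.fst = some e' := by
  induction h with
  | @terminal idx i Q e u hB hd hle =>
    intro U fuel hU hk
    obtain ⟨fuel, rfl⟩ := Nat.exists_eq_add_of_le' hk
    rw [← hU.dom_eq] at hB
    have ha : toF (addEntry U (lineBox u.primed idx i).1 (e, u)) =
      Function.update (toF U) (lineBox u.primed idx i) (some (e, u)) := toF_addEntry hB (e, u)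
    refine ⟨_, hmIns_terminal hB fun j y hy => ?_, hU.update (hU.full.addEntry _) ha fun hb => ?_,
      length_flatten_addEntry _, by rw [ha]; simp⟩
    · obtain ⟨h1, h2⟩ := hU.key_eq hy
      rw [← h2]
      exact hle j _ h1
    · by_contra hu
      rw [onDiag, decide_eq_true_eq, lineBox_diag] at hb
      exact hd (by simpa using hu) hb
  | @off k idx i Q e u v Q' B e' hi hv huv hle h ih =>
    intro U fuel hU hk
    obtain ⟨fuel, rfl⟩ := Nat.exists_eq_add_of_le' (le_of_add_le_right hk)
    obtain ⟨y, hy, rfl⟩ := hU.exists_of_eq hv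
    have hb : onDiag (lineBox u.primed idx i) = false := by
      rw [onDiag, decide_eq_false_iff_not, lineBox_diag]
      exact hi
    have hm := mem_dom hy
    rw [ext_of_not_diag hb] at huv ih
    rw [hmIns_off hi hy huv fun j w hj hw => ?_]
    · have hs := hU.update (b := lineBox u.primed idx i) (hU.full.setEntryG hm _)
        (toF_setEntryG hm (y.1, u)) (by simp [hb])
      rw [ext_of_not_diag hb] at hs
      have := ih hs (Nat.le_of_succ_le_succ hk)
      rwa [length_flatten_setEntryG hm] at this
    · obtain ⟨h1, h2⟩ := hU.key_eq hw
      rw [← h2]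
      exact hle j _ hj h1
  | @diag k idx Q e u v Q' B e' hu hv huv h ih =>
    intro U fuel hU hk
    obtain ⟨fuel, rfl⟩ := Nat.exists_eq_add_of_le' (le_of_add_le_right hk)
    obtain ⟨y, hy, rfl⟩ := hU.exists_of_eq hv
    have hb : onDiag (idx, idx) = true := by simp [onDiag]
    have hm := mem_dom hy
    have hp := (hU.key_eq hy).2
    rw [key, hb, cond_true] at hp
    rw [hp] at huv
    rw [hu, hmIns_diag hy huv]
    have hs := hU.update (hU.full.setEntryG hm _)
      (toF_setEntryG hm (bif sp then (y.1, u) else (e, u)))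
      (by cases sp <;> simpa using fun _ => hu)
    have := ih (U := setEntryG U idx idx (bif sp then (y.1, u) else (e, u))) (fuel := fuel)
      (by cases sp <;> simpa [ext] using hs) (Nat.le_of_succ_le_succ hk)
    rw [length_flatten_setEntryG hm] at this
    cases sp <;> simpa [ext, hb] using this

/-! ### Insertion and recording tableaux of words -/

theorem addBox_eq {R T T' : STab} {B : ℕ × ℕ} (hB : Corner (dom (toF T)) B)
    (hT' : dom (toF T') = insert B (dom (toF T))) (x : Letter) :
    addBox R T T' x = addEntry R B.1 x := by
  obtain ⟨r, c⟩ := B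
  have hl := hB.length_row
  have hle := hB.le
  have hmem : (r, c) ∈ dom (toF T') := by rw [hT']; exact Set.mem_insert _ _
  have hfind : (List.range T'.length).find?
      (fun s => decide ((T.getD s []).length ≠ (T'.getD s []).length)) = some r := by
    rw [List.find?_range_eq_some]
    refine ⟨?_, List.mem_range.2 (lt_length_of_mem hmem), fun s hs => ?_⟩
    · have := (mem_dom_toF.1 hmem).2
      simp only at hle
      simp only [ne_eq, decide_eq_true_eq]
      omega
    · have h : ∀ y, (s, y) ∈ dom (toF T') ↔ (s, y) ∈ dom (toF T) := fun y => by
        rw [hT', Set.mem_insert_iff, Prod.mk.injEq]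
        exact or_iff_right fun h => hs.ne h.1
      have h1 := h (s + (T.getD s []).length)
      have h2 := h (s + (T'.getD s []).length)
      simp only [mem_dom_toF] at h1 h2
      have : (T.getD s []).length = (T'.getD s []).length := by omega
      simp only [this, ne_eq, not_true_eq_false, decide_false, Bool.not_false]
  unfold addBox
  rw [hfind]
  rfl

def swInsert (sp : Bool) (T : STab) (u : Letter) : STab × Bool :=
  bif sp then swInsertSp T u else swInsertO T u

theorem swInsert_eq (sp : Bool) (T : STab) (u : Letter) :
    swInsert sp T u = swIns sp false (T.flatten.length + T.length + 2) T 0 u := by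
  cases sp <;> rfl

def PSW (sp : Bool) (L : List (ℕ × Letter)) : STab :=
  L.foldl (fun T p => (swInsert sp T p.2).1) []

def QSW (sp : Bool) (L : List (ℕ × Letter)) : STab := QSWaux (swInsert sp) [] [] L

theorem QSWaux_append (ins : STab → Letter → STab × Bool) (L L' : List (ℕ × Letter)) (T R : STab) :
    QSWaux ins T R (L ++ L') =
      QSWaux ins (L.foldl (fun T p => (ins T p.2).1) T) (QSWaux ins T R L) L' := by
  induction L generalizing T R with
  | nil => rfl
  | cons p L ih => exact ih _ _

theorem toF_nil {α : Type} : toF ([] : List (List α)) = fun _ => none := by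
  ext1 b
  simp [toF, entryG?]

theorem full_nil {α : Type} : Full ([] : List (List α)) := by simp [Full]

/-- The label and the letter of a column of a compatible sequence. -/
def label (p : ℕ × Letter) : ℤ × Letter := ((p.1 : ℤ), p.2)

theorem Run.exec {sp : Bool} {w : List (ℤ × Letter)} {P Q : FTab Letter} {v : ℤ} {B₀ : ℕ × ℕ}
    {p₀ : Bool} (h : Run sp w P Q v B₀ p₀) :
    ∀ {L : List (ℕ × Letter)}, (L.map label).reverse = w →
      Full (PSW sp L) ∧ toF (PSW sp L) = P ∧ Full (QSW sp L) ∧ toF (QSW sp L) = Q ∧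
        (PSW sp L).flatten.length = w.length := by
  induction h with
  | nil =>
    intro L hL
    obtain rfl : L = [] := by simpa using hL
    exact ⟨full_nil, toF_nil, full_nil, toF_nil, rfl⟩
  | @cons w P Q v B₀ p₀ l x k P' B fl h hs hk hl hv ha ih =>
    intro L hL
    rcases List.eq_nil_or_concat L with rfl | ⟨L, p, rfl⟩
    · simp at hL
    · rw [List.concat_eq_append, List.map_append, List.reverse_append, List.map_singleton,
        List.reverse_singleton, List.singleton_append, List.cons.injEq] at hL
      obtain ⟨hp, hL⟩ := hL
      obtain ⟨h1, h2, h3, h4, h5⟩ := ih hL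
      obtain ⟨hc, hd⟩ := hs.corner
      rw [label, Prod.mk.injEq] at hp
      obtain ⟨hp1, hp2⟩ := hp
      obtain ⟨T', e1, e2, e3, e4⟩ := hs.exec
        (fuel := (PSW sp L).flatten.length + (PSW sp L).length + 2) h1 h2 (by omega)
      rw [← swInsert_eq, ← hp2] at e1
      have hP : PSW sp (L.concat p) = T' := by
        rw [PSW, List.concat_eq_append, List.foldl_append]
        exact congrArg Prod.fst e1
      have hQ : QSW sp (L.concat p) = addEntry (QSW sp L) B.1 ⟨l, fl⟩ := by
        rw [QSW, List.concat_eq_append, QSWaux_append]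
        change addBox (QSW sp L) (PSW sp L) (swInsert sp (PSW sp L) p.2).1
          ⟨(p.1 : ℤ), (swInsert sp (PSW sp L) p.2).2⟩ = _
        rw [e1, hp1]
        exact addBox_eq (by rwa [h2]) (by rw [e3, hd, h2]) _
      rw [hP, hQ, e4, h5]
      refine ⟨e2, e3, h3.addEntry _, ?_, rfl⟩
      rw [← h4]
      exact toF_addEntry (by rwa [h4, ← h.dom_eq]) _

/-! ### Sorting -/

theorem insSortedCS_perm (p : ℕ × Letter) (L : List (ℕ × Letter)) :
    (insSortedCS p L).Perm (p :: L) := by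
  induction L with
  | nil => exact List.Perm.refl _
  | cons q L ih =>
    unfold insSortedCS
    split
    · exact List.Perm.refl _
    · exact (ih.cons q).trans (List.Perm.swap p q L)

theorem sortCS_perm (L : List (ℕ × Letter)) : (sortCS L).Perm L := by
  induction L with
  | nil => exact List.Perm.refl _
  | cons p L ih => exact (insSortedCS_perm p _).trans (ih.cons p)

theorem insSortedCS_append_right {p : ℕ × Letter} {A : List (ℕ × Letter)} (C : List (ℕ × Letter))
    (h : ∀ a ∈ A, a.1 < p.1) : insSortedCS p (A ++ C) = A ++ insSortedCS p C := by
  induction A with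
  | nil => rfl
  | cons a A ih =>
    have ha := h a (List.mem_cons_self ..)
    rw [List.cons_append, insSortedCS, if_neg (by omega),
      ih fun b hb => h b (List.mem_cons_of_mem _ hb), List.cons_append]

theorem insSortedCS_append_left {p : ℕ × Letter} (A : List (ℕ × Letter)) {C : List (ℕ × Letter)}
    (h : ∀ c ∈ C.head?, p.1 < c.1 ∨ p.1 = c.1 ∧ p.2 ≤ c.2) :
    insSortedCS p (A ++ C) = insSortedCS p A ++ C := by
  induction A with
  | nil =>
    cases C with
    | nil => rfl
    | cons c C =>
      simp only [insSortedCS, List.nil_append, List.cons_append, if_pos (h c rfl)]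
  | cons a A ih =>
    rw [List.cons_append, insSortedCS, insSortedCS]
    split
    · rfl
    · rw [ih, List.cons_append]

/-- Adding a column whose letter is maximal to a list, and sorting. -/
theorem exists_sortCS_append {p : ℕ × Letter} {L : List (ℕ × Letter)} (h : ∀ q ∈ L, q.2 < p.2) :
    ∃ A C, sortCS L = A ++ C ∧ sortCS (L ++ [p]) = A ++ p :: C ∧
      (∀ a ∈ A, a.1 ≤ p.1) ∧ ∀ c ∈ C, p.1 < c.1 := by
  induction L with
  | nil => exact ⟨[], [], rfl, rfl, by simp, by simp⟩
  | cons q L ih =>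
    obtain ⟨A, C, h1, h2, h3, h4⟩ := ih fun q hq => h q (List.mem_cons_of_mem _ hq)
    have hq := h q (List.mem_cons_self ..)
    have e1 : sortCS (q :: L) = insSortedCS q (A ++ C) := by rw [← h1]; rfl
    have e2 : sortCS (q :: L ++ [p]) = insSortedCS q (A ++ p :: C) := by rw [← h2]; rfl
    by_cases hqp : q.1 ≤ p.1
    · refine ⟨insSortedCS q A, C, ?_, ?_, fun a ha => ?_, h4⟩
      · rw [e1, insSortedCS_append_left]
        intro c hc
        have := h4 c (List.mem_of_mem_head? hc)
        omega
      · rw [e2, insSortedCS_append_left]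
        intro c hc
        obtain rfl : p = c := by simpa using hc
        rcases hqp.lt_or_eq with h5 | h5
        · exact Or.inl h5
        · exact Or.inr ⟨h5, hq.le⟩
      · rcases List.mem_cons.1 ((insSortedCS_perm q A).mem_iff.1 ha) with rfl | ha
        · exact hqp
        · exact h3 a ha
    · rw [not_le] at hqp
      refine ⟨A, insSortedCS q C, ?_, ?_, h3, fun c hc => ?_⟩
      · rw [e1, insSortedCS_append_right _ fun a ha => (h3 a ha).trans_lt hqp]
      · rw [e2, insSortedCS_append_right _ fun a ha => (h3 a ha).trans_lt hqp]
        congr 1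
        exact insSortedCS_append_right (A := [p]) C (by simpa using hqp)
      · rcases List.mem_cons.1 ((insSortedCS_perm q C).mem_iff.1 hc) with rfl | hc
        · exact hqp
        · exact h4 c hc

/-! ### Duality -/

theorem hmAuxCS_append (sp : Bool) (L L' : List (ℕ × Letter)) (U : MTab) (R : STab) :
    hmAuxCS sp U R (L ++ L') =
      hmAuxCS sp (hmAuxCS sp U R L).1 (hmAuxCS sp U R L).2 L' := by
  induction L generalizing U R with
  | nil => rfl
  | cons p L ih => exact ih _ _

def extract (sp : Bool) (U : MTab) : STab := bif sp then extractSp U else extractO U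

theorem MRep.extract {sp : Bool} {U : MTab} {Q : FTab Letter} (h : MRep sp U Q) :
    Full (extract sp U) ∧ toF (extract sp U) = Q := by
  cases sp
  · refine ⟨fun row hrow => ?_, ?_⟩
    · obtain ⟨row', h1, rfl⟩ := List.mem_map.1 hrow
      have := h.full _ h1
      cases row' <;> simp_all
    · ext1 b
      obtain ⟨r, c⟩ := b
      rw [h.map]
      have hd := h.diag (r, c)
      simp only [ShiftedDuality.extract, cond_false]
      rw [toF_apply] at *
      have hg : (extractO U).getD r [] = match U.getD r [] with
        | [] => []
        | (e, x) :: rest => (if e then (⟨x.ceil, true⟩ : Letter) else x) :: rest.map Prod.snd := by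
        simp only [List.getD_eq_getElem?_getD, extractO, List.getElem?_map]
        cases U[r]? <;> rfl
      rw [hg, toF_apply]
      split
      · next hrc =>
        cases hrow : U.getD r [] with
        | nil => simp
        | cons q rest =>
          obtain ⟨e, x⟩ := q
          obtain ⟨k, rfl⟩ := Nat.exists_eq_add_of_le hrc
          rw [Nat.add_sub_cancel_left]
          cases k with
          | zero =>
            have hx : x.primed = false :=
              hd (e, x) (by rw [if_pos hrc, hrow]; simp) (by simp [onDiag])
            obtain ⟨n, p⟩ := x
            simp only at hx
            subst hx
            cases e <;> simp [ext, onDiag]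
          | succ k =>
            have hb : onDiag (r, r + (k + 1)) = false := by simp [onDiag]
            simp only [List.getElem?_cons_succ, List.getElem?_map]
            congr 1
            ext1 q
            rw [ext_of_not_diag hb]
      · rfl
  · refine ⟨fun row hrow => ?_, ?_⟩
    · obtain ⟨row', h1, rfl⟩ := List.mem_map.1 hrow
      simpa using h.full _ h1
    · ext1 b
      obtain ⟨r, c⟩ := b
      rw [h.map, toF_apply, toF_apply]
      have hg : (extractSp U).getD r [] = (U.getD r []).map Prod.snd := by
        simp only [List.getD_eq_getElem?_getD, extractSp, List.getElem?_map]
        cases U[r]? <;> rfl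
      simp only [ShiftedDuality.extract, cond_true, hg]
      split
      · rw [List.getElem?_map]; rfl
      · rfl

theorem exists_run_hmAuxCS (sp : Bool) (φ : List (ℕ × Letter)) (hpos : ∀ p ∈ φ, 0 < p.2.ceil)
    (hφ : φ.Pairwise fun p q => p.1 < q.1) :
    ∃ P Q v B p, Run sp ((transposeCS φ).map label).reverse P Q v B p ∧
      MRep sp (hmAuxCS sp [] [] φ).1 Q ∧
      (hmAuxCS sp [] [] φ).1.flatten.length = φ.length ∧
      Full (hmAuxCS sp [] [] φ).2 ∧ toF (hmAuxCS sp [] [] φ).2 = P := by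
  induction φ using List.reverseRecOn with
  | nil =>
    refine ⟨_, _, _, _, _, Run.nil, ⟨full_nil, fun b => ?_, fun b y hy => ?_⟩,
      rfl, full_nil, toF_nil⟩
    · change none = (toF ([] : MTab) b).map _
      rw [toF_nil]; rfl
    · change toF ([] : MTab) b = some y at hy
      rw [toF_nil] at hy
      exact absurd hy (by simp)
  | append_singleton φ p ih =>
    rw [List.pairwise_append] at hφ
    obtain ⟨P, Q, v, B, p₀, hR, hU, hlen, hF, hP⟩ :=
      ih (fun q hq => hpos q (List.mem_append_left _ hq)) hφ.1
    have hlt : ∀ q ∈ φ, q.1 < p.1 := fun q hq => hφ.2.2 q hq p (List.mem_singleton_self p)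
    have hp : 0 < p.2.ceil := hpos p (by simp)
    set t : ℕ × Letter → ℕ × Letter := fun p => (p.2.ceil.toNat, ⟨(p.1 : ℤ), p.2.primed⟩) with ht
    have hlt' : ∀ q ∈ φ.map t, q.2.ceil < (t p).2.ceil := fun q hq => by
      obtain ⟨a, ha, rfl⟩ := List.mem_map.1 hq
      exact Int.ofNat_lt.2 (hlt a ha)
    obtain ⟨A, C, h1, h2, h3, h4⟩ := exists_sortCS_append (p := t p) (L := φ.map t)
      fun q hq => (letter_lt_iff _ _).2 (Or.inl (hlt' q hq))
    have hperm := sortCS_perm (φ.map t)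
    rw [h1] at hperm
    have e1 : ((transposeCS φ).map label).reverse =
        (C.map label).reverse ++ (A.map label).reverse := by
      rw [transposeCS, h1]; simp
    have e2 : ((transposeCS (φ ++ [p])).map label).reverse =
        (C.map label).reverse ++ label (t p) :: (A.map label).reverse := by
      rw [transposeCS, List.map_append, List.map_singleton, h2]; simp
    have hl : label (t p) = (p.2.ceil, ⟨(p.1 : ℤ), p.2.primed⟩) := by
      simp [label, ht, Int.toNat_of_nonneg hp.le]
    have hlen' : ((C.map label).reverse ++ (A.map label).reverse).length = φ.length := by
      have := hperm.length_eq
      simp only [List.length_append, List.length_map, List.length_reverse] at this ⊢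
      omega
    rw [e1] at hR
    rw [e2, hl]
    obtain ⟨Q₁, v₁, B₁, p₁, b, e, k, hR₁, hb, hM, hk, -⟩ := hR.add_letter
      (m := ⟨(p.1 : ℤ), p.2.primed⟩) hp
      (fun q hq => by
        obtain ⟨a, ha, rfl⟩ := List.mem_map.1 (List.mem_reverse.1 hq)
        have := h3 a ha
        simp only [ht, label] at this ⊢
        omega)
      (fun q hq => by
        obtain ⟨a, ha, rfl⟩ := List.mem_map.1 (List.mem_reverse.1 hq)
        have := h4 a ha
        simp only [ht, label] at this ⊢
        omega)
      (fun q hq => by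
        have : q ∈ (A ++ C).map label := by
          rw [List.map_append, List.mem_append]
          rw [List.mem_append, List.mem_reverse, List.mem_reverse] at hq
          exact hq.symm
        obtain ⟨a, ha, rfl⟩ := List.mem_map.1 this
        exact hlt' a (hperm.mem_iff.1 ha))
    obtain ⟨U', f1, f2, f3, f4⟩ := hM.exec
      (fuel := 2 * (hmAuxCS sp [] [] φ).1.flatten.length + 4) hU (by omega)
    have hstep : hmAuxCS sp [] [] (φ ++ [p]) =
        (U', addEntry (hmAuxCS sp [] [] φ).2 b.1 (place sp b ⟨(p.1 : ℤ), e⟩)) := by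
      rw [hmAuxCS_append]
      have hins : hmInsert sp (hmAuxCS sp [] [] φ).1 p.2 = (U', b) := f1
      have hsgn : (entryG? U' b.1 b.2).map Prod.fst = some e := f4
      simp only [hmAuxCS, hins, hsgn, Option.getD_some]
      congr 2
      cases sp <;> simp [place, onDiag, Letter.unprime]
      by_cases hd : b.1 = b.2 <;> simp [hd]
    refine ⟨_, Q₁, v₁, B₁, p₁, hR₁, ?_⟩
    rw [hstep]
    refine ⟨f2, ?_, hF.addEntry _, ?_⟩
    · rw [f3, hlen, List.length_append, List.length_singleton]
    · subst hP
      exact toF_addEntry hb _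

theorem hmAuxCS_eq (sp : Bool) {φ : List (ℕ × Letter)} (hφ : IsPrimedCompatible φ)
    (hs : IsIndexStrict φ) :
    extract sp (hmAuxCS sp [] [] φ).1 = QSW sp (transposeCS φ) ∧
      (hmAuxCS sp [] [] φ).2 = PSW sp (transposeCS φ) := by
  have : IsTrans (ℕ × Letter) fun p q => p.1 < q.1 := ⟨fun _ _ _ => lt_trans⟩
  obtain ⟨P, Q, v, B, p, hR, hU, -, hF, hP⟩ := exists_run_hmAuxCS sp φ
    (fun p hp => (hφ.1 p hp).2) (List.isChain_iff_pairwise.1 hs)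
  obtain ⟨h1, h2, h3, h4, -⟩ := hR.exec rfl
  obtain ⟨h5, h6⟩ := hU.extract
  exact ⟨h5.eq_of_toF h3 (h6.trans h4.symm), hF.eq_of_toF h1 (hP.trans h2.symm)⟩

end ShiftedDuality

/-- Theorem 5.11: for an index-strict primed compatible sequence `φ`,
`P_HMᴼ(φ) = Q_SWᴼ(φ^⊤)`, `Q_HMᴼ(φ) = P_SWᴼ(φ^⊤)`, `P_HM^Sp(φ) = Q_SW^Sp(φ^⊤)`, and
`Q_HM^Sp(φ) = P_SW^Sp(φ^⊤)`. -/
theorem stmt19 (φ : List (ℕ × Letter)) (h : IsPrimedCompatible φ) (hs : IsIndexStrict φ) :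
    PHMO φ = QSWO (transposeCS φ) ∧ QHMO φ = PSWO (transposeCS φ) ∧
    PHMSp φ = QSWSp (transposeCS φ) ∧ QHMSp φ = PSWSp (transposeCS φ) := by
  have hO := ShiftedDuality.hmAuxCS_eq false h hs
  have hSp := ShiftedDuality.hmAuxCS_eq true h hs
  exact ⟨hO.1, hO.2, hSp.1, hSp.2⟩
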